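/- arXiv:math/0410478 — 8 statements merged into one kernel-verified Lean document; each statement's English description precedes it below -/
import Mathlib

section
/- Theorem (existence of an inversion matrix implies birationality). If an inversion-matrix datum for φ exists, then φ is proper, i.e. the subfield K(φ₁,φ₂,φ₃) of K(u,v) equals all of K(u,v). -/
open MvPolynomial

/-- The rational function field `K(u,v)`, realized as the fraction field of `K[u,v]`. -/
noncomputable abbrev RatFuncTwo (K : Type*) [Field K] : Type _ :=
  FractionRing (MvPolynomial (Fin 2) K)

/-- The three affine coordinates `φᵢ = pᵢ(u,v,1)/p₄(u,v,1)` (for `i = 1,2,3`) of the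
parameterization `φ` determined by `p = (p₁,p₂,p₃,p₄)`, as elements of `K(u,v)`. -/
noncomputable def phiCoord {K : Type*} [Field K]
    (p : Fin 4 → MvPolynomial (Fin 3) K) (i : Fin 3) : RatFuncTwo K :=
  algebraMap (MvPolynomial (Fin 2) K) (RatFuncTwo K)
      (aeval ![X 0, X 1, 1] (p i.castSucc)) /
    algebraMap (MvPolynomial (Fin 2) K) (RatFuncTwo K) (aeval ![X 0, X 1, 1] (p 3))

/-- `φ` is proper (birational onto its image) if the subfield `K(φ₁,φ₂,φ₃)` of `K(u,v)`
generated over `K` by `φ₁, φ₂, φ₃` is all of `K(u,v)`. -/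
noncomputable def IsProperParam {K : Type*} [Field K]
    (p : Fin 4 → MvPolynomial (Fin 3) K) : Prop :=
  IntermediateField.adjoin K {phiCoord p 0, phiCoord p 1, phiCoord p 2} = ⊤

open scoped Matrix

theorem aeval_mul_const_of_isHomogeneous {σ R B : Type*} [CommSemiring R]
    [CommSemiring B] [Algebra R B] {q : MvPolynomial σ R} {d : ℕ} (hq : q.IsHomogeneous d)
    (c : B) (z : σ → B) : aeval (fun i => c * z i) q = c ^ d * aeval z q := by
  rw [aeval_def, aeval_def, eval₂_eq, eval₂_eq, Finset.mul_sum]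
  refine Finset.sum_congr rfl fun e he => ?_
  have hdeg : ∑ i ∈ e.support, e i = d := by
    rw [← hq (mem_support_iff.mp he), Finsupp.weight_apply, Finsupp.sum]
    simp
  simp_rw [mul_pow]
  rw [Finset.prod_mul_distrib, Finset.prod_pow_eq_pow_sum, hdeg]
  ring

/-- The left kernel of an `(n + 1) × n` matrix of rank `n` is at most a line. -/
theorem Matrix.exists_smul_eq_of_vecMul_eq_zero {F : Type*} [Field F] {n : ℕ}
    {M : Matrix (Fin (n + 1)) (Fin n) F} (hM : M.rank = n) {x y : Fin (n + 1) → F}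
    (hx : x ᵥ* M = 0) (hy : y ᵥ* M = 0) (hx0 : x ≠ 0) : ∃ c : F, c • x = y := by
  have hker : Module.finrank F (LinearMap.ker Mᵀ.mulVecLin) = 1 := by
    have h := LinearMap.finrank_range_add_finrank_ker Mᵀ.mulVecLin
    change Mᵀ.rank + _ = _ at h
    rw [Matrix.rank_transpose, hM, Module.finrank_fin_fun] at h
    omega
  have mem {z : Fin (n + 1) → F} (hz : z ᵥ* M = 0) : z ∈ LinearMap.ker Mᵀ.mulVecLin := by
    simpa [Matrix.mulVec_transpose] using hz
  obtain ⟨c, hc⟩ := (finrank_eq_one_iff_of_nonzero' (⟨x, mem hx⟩ : LinearMap.ker Mᵀ.mulVecLin)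
    (by simpa [Subtype.ext_iff] using hx0)).mp hker ⟨y, mem hy⟩
  exact ⟨c, congrArg Subtype.val hc⟩

/-- Let `M` have entries in a subfield `L` of `E` and rank `n` after an extension `E → F` of scalars
and a rescaling of its columns. Then the left kernel of `M` is spanned by a vector over `L`, that is,
ratios of coordinates of a vector in the left kernel lie in `L`. -/
theorem IntermediateField.div_mem_of_vecMul_eq_zero {K E F : Type*} [Field K] [Field E] [Field F]
    [Algebra K E] (L : IntermediateField K E) (ι : E →+* F) {n : ℕ}
    {M : Matrix (Fin (n + 1)) (Fin n) E} (hM : ∀ i j, M i j ∈ L)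
    {M' : Matrix (Fin (n + 1)) (Fin n) F} (c : Fin n → F) (hM' : ∀ i j, M' i j = c j * ι (M i j))
    (hrank : M'.rank = n) {x : Fin (n + 1) → E} (hx : x ᵥ* M = 0) (k l : Fin (n + 1)) :
    x k / x l ∈ L := by
  by_cases hl : x l = 0
  · simp [hl]
  by_contra hrL
  obtain ⟨f, hfr, hf⟩ := Submodule.exists_le_ker_of_notMem
    (p := Submodule.span L {(1 : E)}) (v := x k / x l) (by
      rw [Submodule.mem_span_singleton]
      rintro ⟨a, ha⟩
      apply hrL
      rw [← ha, Algebra.smul_def, mul_one]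
      exact a.2)
  have hf1 : f 1 = 0 := hf (Submodule.mem_span_singleton_self _)
  let y : Fin (n + 1) → E := fun i => (f (x i / x l) : L)
  have hy : y ᵥ* M = 0 := by
    funext j
    have h : ∑ i, (⟨_, hM i j⟩ : L) • (x i / x l) = 0 := by
      rw [← zero_div (x l), ← show ∑ i, x i * M i j = 0 from congrFun hx j, Finset.sum_div]
      refine Finset.sum_congr rfl fun i _ => ?_
      rw [Algebra.smul_def]
      change M i j * (x i / x l) = x i * M i j / x l
      ring
    have h' := congrArg (fun z => L.val (f z)) h
    simp only [map_sum, map_smul, map_zero, smul_eq_mul, map_mul] at h'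
    change ∑ i, y i * M i j = 0
    rw [← h']
    exact Finset.sum_congr rfl fun i _ => mul_comm _ _
  have extend {z : Fin (n + 1) → E} (hz : z ᵥ* M = 0) : (fun i => ι (z i)) ᵥ* M' = 0 := by
    funext j
    have h := congrArg (fun w => c j * ι w) (show ∑ i, z i * M i j = 0 from congrFun hz j)
    simp only [map_sum, map_mul, map_zero, mul_zero, Finset.mul_sum] at h
    simp only [Matrix.vecMul, dotProduct, hM', Pi.zero_apply]
    rw [← h]
    exact Finset.sum_congr rfl fun i _ => mul_left_comm _ _ _
  obtain ⟨a, ha⟩ := Matrix.exists_smul_eq_of_vecMul_eq_zero hrank (extend hx) (extend hy)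
    (fun h => hl (by simpa using congrFun h l))
  have hyl : y l = 0 := by simp [y, div_self hl, hf1]
  have ha0 : a = 0 := by simpa [hyl, hl] using congrFun ha l
  have hyk : y k = 0 := by simpa [ha0, eq_comm (a := (0 : F))] using congrFun ha k
  exact hfr (by simpa [y] using hyk)

theorem IntermediateField.mvPolynomial_aeval_mem {K E σ : Type*} [Field K] [Field E] [Algebra K E]
    (L : IntermediateField K E) {z : σ → E} (hz : ∀ i, z i ∈ L) (q : MvPolynomial σ K) :
    aeval z q ∈ L := by
  induction q using MvPolynomial.induction_on with
  | C a => simp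
  | add q r hq hr => rw [map_add]; exact add_mem hq hr
  | mul_X q i hq => rw [map_mul, aeval_X]; exact mul_mem hq (hz i)

section

variable (K : Type*) [Field K]

/-- The inclusion of `K[u,v]` in `K(t₁,t₂,t₃)` sending `u, v` to `t₁/t₃, t₂/t₃`. -/
noncomputable def ratioAlgHom :
    MvPolynomial (Fin 2) K →ₐ[K] FractionRing (MvPolynomial (Fin 3) K) :=
  aeval fun i : Fin 2 => (algebraMap (MvPolynomial (Fin 3) K) _ (X i.castSucc)) /
    algebraMap (MvPolynomial (Fin 3) K) _ (X 2)

theorem algebraMap_X_two_ne_zero :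
    algebraMap (MvPolynomial (Fin 3) K) (FractionRing (MvPolynomial (Fin 3) K)) (X 2) ≠ 0 := by
  simp [X_ne_zero]

/-- Auxiliary form of `ratioAlgHom_injective`, through any model of `K[t₁,t₂,t₃,t₃⁻¹]`. -/
theorem ratioAlgHom_injective_of_isLocalizationAway (R : Type*) [CommRing R] [Algebra K R]
    [Algebra (MvPolynomial (Fin 3) K) R] [IsScalarTower K (MvPolynomial (Fin 3) K) R]
    [IsLocalization.Away (X 2 : MvPolynomial (Fin 3) K) R] :
    Function.Injective (ratioAlgHom K) := by
  let s : MvPolynomial (Fin 3) K →ₐ[K] MvPolynomial (Fin 2) K := aeval ![X 0, X 1, 1]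
  have hs : IsUnit (s.toRingHom (X 2)) := by simp [s]
  let retr : R →+* MvPolynomial (Fin 2) K := IsLocalization.Away.lift (X 2) hs
  have hretr (q) : retr (algebraMap _ R q) = s q := IsLocalization.Away.lift_eq (X 2) hs q
  let toFrac : R →+* FractionRing (MvPolynomial (Fin 3) K) :=
    IsLocalization.Away.lift (X 2) (g := algebraMap _ _) (algebraMap_X_two_ne_zero K).isUnit
  have htoFrac (q) : toFrac (algebraMap _ R q) = algebraMap _ _ q :=
    IsLocalization.Away.lift_eq (X 2) _ q
  let iv : R := IsLocalization.Away.invSelf (X 2 : MvPolynomial (Fin 3) K)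
  have hinv : algebraMap (MvPolynomial (Fin 3) K) R (X 2) * iv = 1 :=
    IsLocalization.Away.mul_invSelf (X 2)
  let g : MvPolynomial (Fin 2) K →ₐ[K] R := aeval fun i : Fin 2 =>
    algebraMap (MvPolynomial (Fin 3) K) R (X i.castSucc) * iv
  have hgC (r : K) : g (C r) = algebraMap (MvPolynomial (Fin 3) K) R (C r) := by
    rw [← algebraMap_eq, AlgHom.commutes, ← algebraMap_eq, ← IsScalarTower.algebraMap_apply]
  have hinvR : retr iv = 1 := by
    have h := congrArg retr hinv
    simpa [map_mul, hretr, s] using h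
  have hinvF : toFrac iv =
      (algebraMap (MvPolynomial (Fin 3) K) _ (X 2))⁻¹ := by
    have h := congrArg toFrac hinv
    rw [map_mul, htoFrac, map_one] at h
    exact eq_inv_of_mul_eq_one_right h
  have hg : Function.Injective g := by
    have hid : retr.comp g.toRingHom = RingHom.id _ := by
      apply MvPolynomial.ringHom_ext
      · intro r
        simp only [RingHom.comp_apply, AlgHom.toRingHom_eq_coe, RingHom.coe_coe, hgC, hretr]
        simp [s]
      · intro i
        fin_cases i <;> simp [g, hretr, hinvR, s]
    exact Function.LeftInverse.injective (g := retr) fun q => RingHom.congr_fun hid q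
  have halg : Function.Injective (algebraMap (MvPolynomial (Fin 3) K) R) :=
    IsLocalization.injective R (powers_le_nonZeroDivisors_of_noZeroDivisors (X_ne_zero 2))
  have htoFrac_inj : Function.Injective toFrac :=
    (IsLocalization.lift_injective_iff _).mpr fun a c => by
      rw [halg.eq_iff, (IsFractionRing.injective (MvPolynomial (Fin 3) K) _).eq_iff]
  have hcomp : (toFrac.comp g.toRingHom) = (ratioAlgHom K).toRingHom := by
    apply MvPolynomial.ringHom_ext
    · intro r
      simp only [RingHom.comp_apply, AlgHom.toRingHom_eq_coe, RingHom.coe_coe, hgC, htoFrac]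
      rw [← algebraMap_eq, ← algebraMap_eq, AlgHom.commutes, ← IsScalarTower.algebraMap_apply]
    · intro i
      simp [g, ratioAlgHom, htoFrac, hinvF, div_eq_mul_inv]
  intro a c h
  exact hg (htoFrac_inj ((RingHom.congr_fun hcomp a).trans
    (h.trans (RingHom.congr_fun hcomp c).symm)))

theorem ratioAlgHom_injective : Function.Injective (ratioAlgHom K) :=
  ratioAlgHom_injective_of_isLocalizationAway K
    (Localization.Away (X 2 : MvPolynomial (Fin 3) K))

/-- The inclusion of `K(u,v)` in `K(t₁,t₂,t₃)` sending `u, v` to `t₁/t₃, t₂/t₃`. -/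
noncomputable def ratioFieldHom :
    RatFuncTwo K →ₐ[K] FractionRing (MvPolynomial (Fin 3) K) :=
  IsFractionRing.liftAlgHom (ratioAlgHom_injective K)

/-- Evaluation of polynomials in `t₁, t₂, t₃` at the point `(u, v, 1)` over `K(u,v)`. -/
noncomputable def evalChart : MvPolynomial (Fin 3) K →ₐ[K] RatFuncTwo K :=
  (IsScalarTower.toAlgHom K (MvPolynomial (Fin 2) K) (RatFuncTwo K)).comp
    (aeval ![X 0, X 1, 1])

variable {K}

theorem evalChart_apply (q : MvPolynomial (Fin 3) K) :
    evalChart K q = algebraMap (MvPolynomial (Fin 2) K) (RatFuncTwo K)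
      (aeval ![X 0, X 1, 1] q) := rfl

theorem pow_mul_ratioFieldHom_evalChart {q : MvPolynomial (Fin 3) K} {N : ℕ}
    (hq : q.IsHomogeneous N) :
    algebraMap (MvPolynomial (Fin 3) K) (FractionRing (MvPolynomial (Fin 3) K)) (X 2) ^ N *
      ratioFieldHom K (evalChart K q) = algebraMap _ _ q := by
  have h3 := algebraMap_X_two_ne_zero K
  let w : Fin 3 → FractionRing (MvPolynomial (Fin 3) K) :=
    fun i => ratioFieldHom K (evalChart K (X i))
  have hw : ratioFieldHom K (evalChart K q) = aeval w q := by
    have : (ratioFieldHom K).comp (evalChart K) = aeval w := by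
      apply MvPolynomial.algHom_ext
      intro i
      simp [w]
    exact DFunLike.congr_fun this q
  have hX : (fun i => algebraMap (MvPolynomial (Fin 3) K)
      (FractionRing (MvPolynomial (Fin 3) K)) (X 2) * w i) = fun i => algebraMap (MvPolynomial (Fin 3) K)
        (FractionRing (MvPolynomial (Fin 3) K)) (X i) := by
    funext i
    fin_cases i <;>
      simp [w, evalChart_apply, ratioFieldHom, ratioAlgHom, IsFractionRing.liftAlgHom_apply,
        IsFractionRing.lift_algebraMap] <;> field_simp
  rw [hw, ← aeval_mul_const_of_isHomogeneous hq, hX]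
  exact (aeval_algebraMap_apply _ X q).trans (by rw [aeval_X_left_apply])

end

/-- existence of an inversion matrix implies birationality.
If an inversion-matrix datum for `φ` exists (a `d × (d-1)` matrix, `d = n+1 ≥ 3`, whose
columns are moving surfaces of positive degrees following `φ`, indexed by `d` distinct
monomials `t^{αᵢ}` of degree `m` among which are `t^{β₁}, t^{β₂}, t^{β₃}` with
`t₁ t^{β₃} = t₃ t^{β₁}` and `t₂ t^{β₃} = t₃ t^{β₂}`, and which has rank `d-1` after
substituting `pᵢ` for `Xᵢ`), then `φ` is proper: `K(φ₁,φ₂,φ₃) = K(u,v)`. -/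
theorem proper_of_inversion_matrix
    (K : Type*) [Field K] [CharZero K]
    (p : Fin 4 → MvPolynomial (Fin 3) K)
    (N : ℕ) (hN : 1 ≤ N) (hphom : ∀ i, (p i).IsHomogeneous N) (hp4 : p 3 ≠ 0)
    (n : ℕ) (hn : 2 ≤ n) (m : ℕ) (hm : 1 ≤ m)
    (α : Fin (n + 1) → (Fin 3 →₀ ℕ)) (hαinj : Function.Injective α)
    (hαdeg : ∀ i, (α i).sum (fun _ e => e) = m)
    (b : Fin 3 → Fin (n + 1))
    (hb1 : (X 0 : MvPolynomial (Fin 3) K) * monomial (α (b 2)) 1 =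
      (X 2 : MvPolynomial (Fin 3) K) * monomial (α (b 0)) 1)
    (hb2 : (X 1 : MvPolynomial (Fin 3) K) * monomial (α (b 2)) 1 =
      (X 2 : MvPolynomial (Fin 3) K) * monomial (α (b 1)) 1)
    (A : Matrix (Fin (n + 1)) (Fin n) (MvPolynomial (Fin 4) K))
    (hAhom : ∀ j : Fin n, ∃ dj : ℕ, 1 ≤ dj ∧ ∀ i, (A i j).IsHomogeneous dj)
    (hAmoving : ∀ j : Fin n,
      ∑ i : Fin (n + 1), (monomial (α i) (1 : K)) * (aeval p) (A i j) = 0)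
    (hArank : ((A.map (aeval p)).map
      (algebraMap (MvPolynomial (Fin 3) K)
        (FractionRing (MvPolynomial (Fin 3) K)))).rank = n) :
    IsProperParam p := by
  set φ : Fin 4 → RatFuncTwo K := fun i => evalChart K (p i) / evalChart K (p 3) with hφdef
  let F := FractionRing (MvPolynomial (Fin 3) K)
  let ι := ratioFieldHom K
  let L := IntermediateField.adjoin K {phiCoord p 0, phiCoord p 1, phiCoord p 2}
  have hp4F : algebraMap _ F (p 3) ≠ 0 := by simpa using hp4
  have hp4E : evalChart K (p 3) ≠ 0 := by
    intro h
    apply hp4F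
    rw [← pow_mul_ratioFieldHom_evalChart (hphom 3), h, map_zero, mul_zero]
  have hφL (i : Fin 4) : φ i ∈ L := by
    have hsub := IntermediateField.subset_adjoin K {phiCoord p 0, phiCoord p 1, phiCoord p 2}
    fin_cases i
    · exact hsub (by simp [hφdef, phiCoord, evalChart_apply])
    · exact hsub (by simp [hφdef, phiCoord, evalChart_apply])
    · exact hsub (by simp [hφdef, phiCoord, evalChart_apply])
    · simp [hφdef, hp4E]
  have hιφ (i : Fin 4) : algebraMap _ F (p 3) * ι (φ i) = algebraMap _ F (p i) := by
    rw [← pow_mul_ratioFieldHom_evalChart (hphom 3), ← pow_mul_ratioFieldHom_evalChart (hphom i)]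
    have : ι (evalChart K (p 3)) ≠ 0 := by simpa using hp4E
    rw [hφdef, map_div₀, mul_assoc, mul_div_cancel₀ _ this]
  have hAL (i j) : aeval φ (A i j) ∈ L := L.mvPolynomial_aeval_mem hφL _
  have hp4φ : (fun k => evalChart K (p 3) * φ k) = fun k => evalChart K (p k) :=
    funext fun k => mul_div_cancel₀ _ hp4E
  have hAF (j : Fin n) : ∃ d : ℕ, ∀ i,
      algebraMap _ F (aeval p (A i j)) = algebraMap _ F (p 3) ^ d * ι (aeval φ (A i j)) := by
    obtain ⟨d, -, hd⟩ := hAhom j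
    refine ⟨d, fun i => ?_⟩
    rw [comp_aeval_apply, ← aeval_mul_const_of_isHomogeneous (hd i), funext hιφ]
    exact (aeval_algebraMap_apply F p (A i j)).symm
  have hAE (j : Fin n) :
      ∑ i, evalChart K (monomial (α i) 1) * aeval φ (A i j) = 0 := by
    obtain ⟨d, -, hd⟩ := hAhom j
    have h := congrArg (evalChart K) (hAmoving j)
    rw [map_sum, map_zero] at h
    have hpow : evalChart K (p 3) ^ d ≠ 0 := pow_ne_zero _ hp4E
    apply (mul_eq_zero.mp _).resolve_left hpow
    rw [Finset.mul_sum, ← h]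
    refine Finset.sum_congr rfl fun i _ => ?_
    rw [map_mul, comp_aeval_apply, mul_left_comm, ← aeval_mul_const_of_isHomogeneous (hd i), hp4φ]
  let x : Fin (n + 1) → RatFuncTwo K := fun i => evalChart K (monomial (α i) 1)
  have hx2 : x (b 2) ≠ 0 := by
    intro h
    have hhom : (monomial (α (b 2)) (1 : K)).IsHomogeneous m :=
      isHomogeneous_monomial _ (hαdeg (b 2))
    have := pow_mul_ratioFieldHom_evalChart hhom
    rw [show evalChart K (monomial (α (b 2)) 1) = 0 from h, map_zero, mul_zero] at this
    simp [eq_comm (a := (0 : F)), F] at this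
  have key (k : Fin (n + 1)) (r : RatFuncTwo K) (hr : r * x (b 2) = x k) : r ∈ L := by
    rw [eq_div_of_mul_eq hx2 hr]
    choose d hd using hAF
    exact L.div_mem_of_vecMul_eq_zero (M := fun i j => aeval φ (A i j)) ι.toRingHom hAL
      (fun j => algebraMap _ F (p 3) ^ d j) (fun i j => hd j i) hArank (funext hAE) k (b 2)
  have hu : evalChart K (X 0) ∈ L := key (b 0) _ (by
    simpa [evalChart_apply, x] using congrArg (evalChart K) hb1)
  have hv : evalChart K (X 1) ∈ L := key (b 1) _ (by
    simpa [evalChart_apply, x] using congrArg (evalChart K) hb2)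
  have hpoly (q : MvPolynomial (Fin 2) K) : algebraMap _ (RatFuncTwo K) q ∈ L := by
    have h := L.mvPolynomial_aeval_mem (z := fun i => algebraMap _ (RatFuncTwo K) (X i))
      (Fin.forall_fin_two.mpr ⟨by simpa [evalChart_apply] using hu,
        by simpa [evalChart_apply] using hv⟩) q
    have haeval := aeval_algebraMap_apply (RatFuncTwo K) (X : _ → MvPolynomial (Fin 2) K) q
    rw [aeval_X_left_apply] at haeval
    exact haeval ▸ h
  change L = ⊤
  refine eq_top_iff.mpr fun z _ => ?_
  obtain ⟨q, r, -, rfl⟩ := IsFractionRing.div_surjective (A := MvPolynomial (Fin 2) K) z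
  exact div_mem (hpoly q) (hpoly r)
end

section
/- Theorem (inversion formulas from an inversion matrix). Given an inversion-matrix datum for φ, let Δ_{αᵢ} ∈ K[X₁,X₂,X₃,X₄] (1 ≤ i ≤ d) denote the signed maximal minor (−1)^i times the determinant of the (d−1)×(d−1) matrix obtained from A by deleting its i-th row. Then for all 1 ≤ i, j ≤ d one has the identity Δ_{αᵢ}(p₁,p₂,p₃,p₄)·t^{α_j} = Δ_{α_j}(p₁,p₂,p₃,p₄)·t^{αᵢ} in K[t₁,t₂,t₃], and Δ_{αᵢ}(p₁,p₂,p₃,p₄) ≠ 0 for every i. In particular t₁·Δ_{β₃}(p₁,p₂,p₃,p₄) = t₃·Δ_{β₁}(p₁,p₂,p₃,p₄) and t₂·Δ_{β₃}(p₁,p₂,p₃,p₄) = t₃·Δ_{β₂}(p₁,p₂,p₃,p₄), so the rational map X ↦ (Δ_{β₁}(X) : Δ_{β₂}(X) : Δ_{β₃}(X)) is an inverse of φ. -/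
open MvPolynomial

namespace Matrix

/-- The `i`-th signed maximal minor of an `(n + 1) × n` matrix. -/
def signedMinor {R : Type*} [CommRing R] {n : ℕ} (M : Matrix (Fin (n + 1)) (Fin n) R)
    (i : Fin (n + 1)) : R :=
  (-1) ^ (i : ℕ) * (M.submatrix i.succAbove id).det

/-- Laplace expansion along an additional first column. -/
lemma det_cons_column {R : Type*} [CommRing R] {n : ℕ} (M : Matrix (Fin (n + 1)) (Fin n) R)
    (w : Fin (n + 1) → R) :
    (of fun i => (Fin.cons (w i) (M i) : Fin (n + 1) → R)).det =
      ∑ i, w i * M.signedMinor i := by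
  rw [det_succ_column_zero]
  refine Finset.sum_congr rfl fun i _ => ?_
  have h : (of fun i => (Fin.cons (w i) (M i) : Fin (n + 1) → R)).submatrix
      i.succAbove Fin.succ = M.submatrix i.succAbove id := by
    ext a c
    simp
  rw [h, signedMinor, of_apply, Fin.cons_zero]
  ring

/-- A nonzero vector in the left kernel of an `(n + 1) × n` matrix over a domain is proportional
to the vector of signed maximal minors. -/
lemma signedMinor_mul_eq_of_vecMul_eq_zero {R : Type*} [CommRing R] [IsDomain R] {n : ℕ}
    (M : Matrix (Fin (n + 1)) (Fin n) R) {v : Fin (n + 1) → R} (hv : v ≠ 0)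
    (h : v ᵥ* M = 0) (i j : Fin (n + 1)) :
    M.signedMinor i * v j = M.signedMinor j * v i := by
  have hdet := det_cons_column M (Pi.single i (v j) - Pi.single j (v i))
  have hker : v ᵥ* (of fun k => (Fin.cons ((Pi.single i (v j) - Pi.single j (v i) :
      Fin (n + 1) → R) k) (M k) : Fin (n + 1) → R)) = 0 := by
    ext k
    refine Fin.cases ?_ (fun k => ?_) k
    · simp [vecMul, dotProduct, mul_sub, Finset.sum_sub_distrib, Pi.single_apply, mul_comm]
    · simpa [vecMul, dotProduct] using congrFun h k
  rw [exists_vecMul_eq_zero_iff.mp ⟨v, hv, hker⟩] at hdet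
  simp only [Pi.sub_apply, sub_mul, Finset.sum_sub_distrib, Pi.single_apply, ite_mul, zero_mul,
    Finset.sum_ite_eq', Finset.mem_univ, if_true] at hdet
  linear_combination -hdet

/-- An `(n + 1) × n` matrix of rank `n` over a field has a nonzero maximal minor. -/
lemma exists_signedMinor_ne_zero {L : Type*} [Field L] {n : ℕ}
    (M : Matrix (Fin (n + 1)) (Fin n) L) (h : M.rank = n) : ∃ i, M.signedMinor i ≠ 0 := by
  by_contra! hzero
  have hli : LinearIndependent L M.col := by
    rw [linearIndependent_iff_card_eq_finrank_span, Set.finrank, ← rank_eq_finrank_span_cols, h,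
      Fintype.card_fin]
  have hlt : Submodule.span L (Set.range M.col) < ⊤ := by
    refine Submodule.lt_top_of_finrank_lt_finrank ?_
    rw [← rank_eq_finrank_span_cols, h]
    simp
  obtain ⟨w, -, hw⟩ := SetLike.exists_of_lt hlt
  have hcons : LinearIndependent L
      (of fun i => (Fin.cons (w i) (M i) : Fin (n + 1) → L)).col := by
    have hcol : (of fun i => (Fin.cons (w i) (M i) : Fin (n + 1) → L)).col =
        Fin.cons w M.col := by
      ext k i
      refine Fin.cases ?_ (fun k => ?_) k <;> simp
    rw [hcol]
    exact hli.finCons hw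
  rw [linearIndependent_cols_iff_isUnit, isUnit_iff_isUnit_det, det_cons_column] at hcons
  simp [hzero] at hcons

/-- Signed maximal minors commute with ring homomorphisms. -/
lemma signedMinor_map {R S : Type*} [CommRing R] [CommRing S] {n : ℕ}
    (M : Matrix (Fin (n + 1)) (Fin n) R) (f : R →+* S) (i : Fin (n + 1)) :
    (M.map f).signedMinor i = f (M.signedMinor i) := by
  simp [signedMinor, RingHom.map_det, submatrix_map]

end Matrix

/-- inversion formulas from an inversion matrix.
Given an inversion-matrix datum for `φ` (a `d × (d-1)` matrix `A`, `d = n+1 ≥ 3`, whose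
columns are moving surfaces of positive degrees following `φ`, indexed by `d` distinct
monomials `t^{αᵢ}` of degree `m` among which are `t^{β₁}, t^{β₂}, t^{β₃}` with
`t₁ t^{β₃} = t₃ t^{β₁}` and `t₂ t^{β₃} = t₃ t^{β₂}`, and which has rank `d-1` after
substituting `pᵢ` for `Xᵢ`), let `Δ_{αᵢ}` be the signed maximal minor of `A` obtained by
deleting its `i`-th row.  Then each `Δ_{αᵢ}(p₁,p₂,p₃,p₄)` is nonzero,
`Δ_{αᵢ}(p)·t^{αⱼ} = Δ_{αⱼ}(p)·t^{αᵢ}` for all `i, j`, and in particular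
`t₁·Δ_{β₃}(p) = t₃·Δ_{β₁}(p)` and `t₂·Δ_{β₃}(p) = t₃·Δ_{β₂}(p)`, so that
`X ↦ (Δ_{β₁}(X) : Δ_{β₂}(X) : Δ_{β₃}(X))` is an inverse of `φ`. -/
theorem inversion_formulas_of_inversion_matrix
    (K : Type*) [Field K] [CharZero K]
    (p : Fin 4 → MvPolynomial (Fin 3) K)
    (N : ℕ) (hN : 1 ≤ N) (hphom : ∀ i, (p i).IsHomogeneous N) (hp4 : p 3 ≠ 0)
    (n : ℕ) (hn : 2 ≤ n) (m : ℕ) (hm : 1 ≤ m)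
    (α : Fin (n + 1) → (Fin 3 →₀ ℕ)) (hαinj : Function.Injective α)
    (hαdeg : ∀ i, (α i).sum (fun _ e => e) = m)
    (b : Fin 3 → Fin (n + 1))
    (hb1 : (X 0 : MvPolynomial (Fin 3) K) * monomial (α (b 2)) 1 =
      (X 2 : MvPolynomial (Fin 3) K) * monomial (α (b 0)) 1)
    (hb2 : (X 1 : MvPolynomial (Fin 3) K) * monomial (α (b 2)) 1 =
      (X 2 : MvPolynomial (Fin 3) K) * monomial (α (b 1)) 1)
    (A : Matrix (Fin (n + 1)) (Fin n) (MvPolynomial (Fin 4) K))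
    (hAhom : ∀ j : Fin n, ∃ dj : ℕ, 1 ≤ dj ∧ ∀ i, (A i j).IsHomogeneous dj)
    (hAmoving : ∀ j : Fin n,
      ∑ i : Fin (n + 1), (monomial (α i) (1 : K)) * (aeval p) (A i j) = 0)
    (hArank : ((A.map (aeval p)).map
      (algebraMap (MvPolynomial (Fin 3) K)
        (FractionRing (MvPolynomial (Fin 3) K)))).rank = n)
    (Δ : Fin (n + 1) → MvPolynomial (Fin 4) K)
    (hΔ : ∀ i : Fin (n + 1),
      Δ i = (-1 : MvPolynomial (Fin 4) K) ^ (i : ℕ) * (A.submatrix i.succAbove id).det) :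
    (∀ i : Fin (n + 1), aeval p (Δ i) ≠ 0) ∧
      (∀ i j : Fin (n + 1),
        aeval p (Δ i) * monomial (α j) (1 : K) = aeval p (Δ j) * monomial (α i) (1 : K)) ∧
      (X 0 : MvPolynomial (Fin 3) K) * aeval p (Δ (b 2)) =
        (X 2 : MvPolynomial (Fin 3) K) * aeval p (Δ (b 0)) ∧
      (X 1 : MvPolynomial (Fin 3) K) * aeval p (Δ (b 2)) =
        (X 2 : MvPolynomial (Fin 3) K) * aeval p (Δ (b 1)) := by
  have hmon : ∀ i, monomial (α i) (1 : K) ≠ 0 := fun i => by simp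
  have hΔp : ∀ i, aeval p (Δ i) = (A.map (aeval p)).signedMinor i := fun i => by
    rw [hΔ i]
    exact (Matrix.signedMinor_map A (aeval p : _ →ₐ[K] _).toRingHom i).symm
  have hprop : ∀ i j : Fin (n + 1),
      aeval p (Δ i) * monomial (α j) (1 : K) = aeval p (Δ j) * monomial (α i) (1 : K) := by
    intro i j
    rw [hΔp, hΔp]
    refine Matrix.signedMinor_mul_eq_of_vecMul_eq_zero _
      (v := fun i => monomial (α i) (1 : K)) (fun h => hmon 0 (congrFun h 0)) ?_ i j
    ext1 k
    exact hAmoving k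
  have hne : ∀ i, aeval p (Δ i) ≠ 0 := by
    obtain ⟨k, hk⟩ := Matrix.exists_signedMinor_ne_zero _ hArank
    rw [Matrix.signedMinor_map, ← hΔp] at hk
    intro i hi
    have hki := hprop i k
    rw [hi, zero_mul] at hki
    exact mul_ne_zero (fun h0 => hk (by rw [h0, map_zero])) (hmon i) hki.symm
  have hratio : ∀ (s t : MvPolynomial (Fin 3) K) (i j : Fin (n + 1)),
      s * monomial (α i) (1 : K) = t * monomial (α j) (1 : K) →
        s * aeval p (Δ i) = t * aeval p (Δ j) := by
    intro s t i j hst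
    refine mul_right_cancel₀ (hmon i) ?_
    linear_combination aeval p (Δ i) * hst + t * hprop i j
  exact ⟨hne, hprop, hratio _ _ _ _ hb1, hratio _ _ _ _ hb2⟩
end

section
/- Theorem (gcd of the maximal minors of an implicitization matrix is a power of the implicit equation). Given an implicitization-matrix datum for φ, there exists a natural number p with p ≤ δ such that the gcd of Δ_{α₁}, …, Δ_{α_d} in K[X₁,X₂,X₃,X₄] is associated to F^p, i.e. equals F^p up to multiplication by a nonzero constant of K. -/
open MvPolynomial

/-- gcd of the maximal minors of an implicitization matrix is a power of
the implicit equation.  Given an implicitization-matrix datum for `φ` (a `d × d` matrix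
`M`, `d = n+1 ≥ 3`, whose first column has homogeneous entries of a common positive degree,
whose other columns are moving surfaces of positive degrees following `φ`, and with
`det M = c·F^δ`), there is `q ≤ δ` such that `F^q` is a gcd of the signed maximal minors
`Δ_{α₁}, …, Δ_{α_d}` of the matrix `M*` obtained by deleting the first column of `M`;
i.e. the gcd of the `Δ_{αᵢ}` equals `F^q` up to a nonzero constant of `K`. -/
theorem gcd_of_minors_is_power_of_implicit_equation
    (K : Type*) [Field K] [CharZero K]
    (p : Fin 4 → MvPolynomial (Fin 3) K)
    (N : ℕ) (hN : 1 ≤ N) (hphom : ∀ i, (p i).IsHomogeneous N) (hp4 : p 3 ≠ 0)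
    (F : MvPolynomial (Fin 4) K)
    (hFhom : ∃ D : ℕ, F.IsHomogeneous D) (hFirr : Irreducible F)
    (hFimp : ∀ G : MvPolynomial (Fin 4) K, aeval p G = 0 ↔ F ∣ G)
    (n : ℕ) (hn : 2 ≤ n) (m : ℕ) (hm : 1 ≤ m)
    (α : Fin (n + 1) → (Fin 3 →₀ ℕ)) (hαinj : Function.Injective α)
    (hαdeg : ∀ i, (α i).sum (fun _ e => e) = m)
    (b : Fin 3 → Fin (n + 1))
    (hb1 : (X 0 : MvPolynomial (Fin 3) K) * monomial (α (b 2)) 1 =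
      (X 2 : MvPolynomial (Fin 3) K) * monomial (α (b 0)) 1)
    (hb2 : (X 1 : MvPolynomial (Fin 3) K) * monomial (α (b 2)) 1 =
      (X 2 : MvPolynomial (Fin 3) K) * monomial (α (b 1)) 1)
    (M : Matrix (Fin (n + 1)) (Fin (n + 1)) (MvPolynomial (Fin 4) K))
    (hcol0 : ∃ e : ℕ, 1 ≤ e ∧ ∀ i, (M i 0).IsHomogeneous e)
    (hcolhom : ∀ j : Fin n, ∃ dj : ℕ, 1 ≤ dj ∧ ∀ i, (M i j.succ).IsHomogeneous dj)
    (hcolmoving : ∀ j : Fin n,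
      ∑ i : Fin (n + 1), (monomial (α i) (1 : K)) * (aeval p) (M i j.succ) = 0)
    (c : K) (hc : c ≠ 0) (δ : ℕ) (hδ : 1 ≤ δ)
    (hMdet : M.det = C c * F ^ δ)
    (Mstar : Matrix (Fin (n + 1)) (Fin n) (MvPolynomial (Fin 4) K))
    (hMstar : ∀ i j, Mstar i j = M i j.succ)
    (Δ : Fin (n + 1) → MvPolynomial (Fin 4) K)
    (hΔ : ∀ i : Fin (n + 1),
      Δ i = (-1 : MvPolynomial (Fin 4) K) ^ (i : ℕ) *
        (Mstar.submatrix i.succAbove id).det)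
    :
    ∃ q : ℕ, q ≤ δ ∧ (∀ i, F ^ q ∣ Δ i) ∧
      (∀ g : MvPolynomial (Fin 4) K, (∀ i, g ∣ Δ i) → g ∣ F ^ q) := by
  have hdvd : ∀ g : MvPolynomial (Fin 4) K, (∀ i, g ∣ Δ i) → g ∣ F ^ δ := by
    intro g hg
    have hdet : M.det = ∑ i, M i 0 * Δ i := by
      rw [Matrix.det_succ_column_zero]
      refine Finset.sum_congr rfl fun i _ => ?_
      have hsub : Mstar.submatrix i.succAbove id = M.submatrix i.succAbove Fin.succ := by
        ext1 k j
        simp [hMstar]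
      rw [hΔ, hsub]
      ring
    have hgdet : g ∣ C c * F ^ δ := by
      rw [← hMdet, hdet]
      exact Finset.dvd_sum fun i _ => (hg i).mul_left _
    have hunit : IsUnit (C c : MvPolynomial (Fin 4) K) := (IsUnit.mk0 c hc).map C
    exact hunit.dvd_mul_left.mp hgdet
  have hle : ∀ k : ℕ, (∀ i, F ^ k ∣ Δ i) → k ≤ δ := fun k hk =>
    (pow_dvd_pow_iff hFirr.ne_zero hFirr.not_isUnit).mp (hdvd _ hk)
  classical
  let q := Nat.findGreatest (fun k => ∀ i, F ^ k ∣ Δ i) δ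
  refine ⟨q, Nat.findGreatest_le δ, ?_, fun g hg => ?_⟩
  · exact Nat.findGreatest_spec (P := fun k => ∀ i, F ^ k ∣ Δ i) (Nat.zero_le δ) (by simp)
  · obtain ⟨k, -, hk⟩ := (dvd_prime_pow hFirr.prime δ).mp (hdvd g hg)
    have hkΔ : ∀ i, F ^ k ∣ Δ i := fun i => hk.symm.dvd.trans (hg i)
    exact hk.dvd.trans (pow_dvd_pow F (Nat.le_findGreatest (hle k hkΔ) hkΔ))
end

section
/- Theorem (constant gcd of minors is equivalent to the rank condition on the coordinate ring of the surface). Given an implicitization-matrix datum for φ, the ideal (F) of K[X₁,X₂,X₃,X₄] is prime; let L denote the fraction field of the integral domain K[X₁,X₂,X₃,X₄]/(F). Then the gcd of Δ_{α₁}, …, Δ_{α_d} in K[X₁,X₂,X₃,X₄] is a nonzero constant of K if and only if the d×(d−1) matrix obtained from M* by reducing all entries modulo (F), viewed as a matrix over L, has rank d−1. -/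
open MvPolynomial

/-- A matrix with one more row than columns has full column rank exactly when one of its maximal
minors does not vanish. -/
theorem Matrix.rank_eq_iff_exists_det_submatrix_succAbove_ne_zero {L : Type*} [Field L] {n : ℕ}
    (A : Matrix (Fin (n + 1)) (Fin n) L) :
    A.rank = n ↔ ∃ i : Fin (n + 1), (A.submatrix i.succAbove id).det ≠ 0 := by
  constructor
  · intro hr
    by_contra! h
    have hli : LinearIndependent L A.col := by
      rw [linearIndependent_iff_card_eq_finrank_span, Set.finrank, ← A.rank_eq_finrank_span_cols,
        hr, Fintype.card_fin]
    obtain ⟨v, hv⟩ : ∃ v, v ∉ Submodule.span L (Set.range A.col) := by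
      by_contra! hv
      have htop := A.rank_eq_finrank_span_cols
      rw [(Submodule.eq_top_iff'.2 hv), finrank_top, Module.finrank_fin_fun, hr] at htop
      omega
    let B : Matrix (Fin (n + 1)) (Fin (n + 1)) L := (Matrix.of (Fin.cons v A.col)).transpose
    have hB : LinearIndependent L B.col := linearIndependent_finCons.2 ⟨hli, hv⟩
    have hdet : B.det = 0 := by
      rw [Matrix.det_succ_column_zero]
      refine Finset.sum_eq_zero fun i _ => ?_
      have hsub : B.submatrix i.succAbove Fin.succ = A.submatrix i.succAbove id := by
        ext k j
        simp [B]
      rw [hsub, h i, mul_zero]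
    exact (Matrix.linearIndependent_cols_iff_isUnit.1 hB |>.map Matrix.detMonoidHom).ne_zero hdet
  · rintro ⟨i, hi⟩
    refine le_antisymm (A.rank_le_width) ?_
    have hrank := Matrix.rank_of_isUnit _ ((Matrix.isUnit_iff_isUnit_det _).2 hi.isUnit)
    rw [Fintype.card_fin] at hrank
    exact hrank.ge.trans (A.rank_submatrix_le i.succAbove id)

/-- constant gcd of minors is equivalent to the rank condition on the
coordinate ring of the surface.  Given an implicitization-matrix datum for `φ`, the ideal
`(F)` is prime; letting `L` be the fraction field of the domain `K[X₁,X₂,X₃,X₄]/(F)`, the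
gcd of the signed maximal minors `Δ_{α₁}, …, Δ_{α_d}` of `M*` is a nonzero constant of `K`
if and only if the matrix obtained from `M*` by reducing its entries modulo `(F)`, viewed
as a matrix over `L`, has rank `d - 1 = n`. -/
theorem gcd_of_minors_isUnit_iff_rank_over_surface
    (K : Type*) [Field K] [CharZero K]
    (p : Fin 4 → MvPolynomial (Fin 3) K)
    (N : ℕ) (hN : 1 ≤ N) (hphom : ∀ i, (p i).IsHomogeneous N) (hp4 : p 3 ≠ 0)
    (F : MvPolynomial (Fin 4) K)
    (hFhom : ∃ D : ℕ, F.IsHomogeneous D) (hFirr : Irreducible F)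
    (hFimp : ∀ G : MvPolynomial (Fin 4) K, aeval p G = 0 ↔ F ∣ G)
    (n : ℕ) (hn : 2 ≤ n) (m : ℕ) (hm : 1 ≤ m)
    (α : Fin (n + 1) → (Fin 3 →₀ ℕ)) (hαinj : Function.Injective α)
    (hαdeg : ∀ i, (α i).sum (fun _ e => e) = m)
    (b : Fin 3 → Fin (n + 1))
    (hb1 : (X 0 : MvPolynomial (Fin 3) K) * monomial (α (b 2)) 1 =
      (X 2 : MvPolynomial (Fin 3) K) * monomial (α (b 0)) 1)
    (hb2 : (X 1 : MvPolynomial (Fin 3) K) * monomial (α (b 2)) 1 =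
      (X 2 : MvPolynomial (Fin 3) K) * monomial (α (b 1)) 1)
    (M : Matrix (Fin (n + 1)) (Fin (n + 1)) (MvPolynomial (Fin 4) K))
    (hcol0 : ∃ e : ℕ, 1 ≤ e ∧ ∀ i, (M i 0).IsHomogeneous e)
    (hcolhom : ∀ j : Fin n, ∃ dj : ℕ, 1 ≤ dj ∧ ∀ i, (M i j.succ).IsHomogeneous dj)
    (hcolmoving : ∀ j : Fin n,
      ∑ i : Fin (n + 1), (monomial (α i) (1 : K)) * (aeval p) (M i j.succ) = 0)
    (c : K) (hc : c ≠ 0) (δ : ℕ) (hδ : 1 ≤ δ)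
    (hMdet : M.det = C c * F ^ δ)
    (Mstar : Matrix (Fin (n + 1)) (Fin n) (MvPolynomial (Fin 4) K))
    (hMstar : ∀ i j, Mstar i j = M i j.succ)
    (Δ : Fin (n + 1) → MvPolynomial (Fin 4) K)
    (hΔ : ∀ i : Fin (n + 1),
      Δ i = (-1 : MvPolynomial (Fin 4) K) ^ (i : ℕ) *
        (Mstar.submatrix i.succAbove id).det)
    :
    (Ideal.span {F}).IsPrime ∧
      ((∃ u : K, u ≠ 0 ∧ (∀ i, (C u : MvPolynomial (Fin 4) K) ∣ Δ i) ∧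
          (∀ g : MvPolynomial (Fin 4) K, (∀ i, g ∣ Δ i) → g ∣ C u)) ↔
        (Matrix.of fun (i : Fin (n + 1)) (j : Fin n) =>
          algebraMap (MvPolynomial (Fin 4) K ⧸ Ideal.span {F})
            (FractionRing (MvPolynomial (Fin 4) K ⧸ Ideal.span {F}))
            (Ideal.Quotient.mk (Ideal.span {F}) (Mstar i j))).rank = n) := by
  have hprime : (Ideal.span {F}).IsPrime :=
    (Ideal.span_singleton_prime hFirr.ne_zero).2 hFirr.prime
  refine ⟨hprime, ?_⟩
  set f : MvPolynomial (Fin 4) K →+* FractionRing (MvPolynomial (Fin 4) K ⧸ Ideal.span {F}) :=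
    (algebraMap _ _).comp (Ideal.Quotient.mk (Ideal.span {F})) with hf
  have hker (x) : f x = 0 ↔ F ∣ x := by
    rw [hf, RingHom.comp_apply, map_eq_zero_iff _ (IsFractionRing.injective _ _),
      Ideal.Quotient.eq_zero_iff_dvd]
  have hminor (i : Fin (n + 1)) :
      ((Matrix.of fun i j => f (Mstar i j)).submatrix i.succAbove id).det = 0 ↔ F ∣ Δ i := by
    have hmap : (Matrix.of fun i j => f (Mstar i j)).submatrix i.succAbove id =
        f.mapMatrix (Mstar.submatrix i.succAbove id) := rfl
    rw [hmap, ← RingHom.map_det, hker, hΔ, IsUnit.dvd_mul_left (isUnit_one.neg.pow _)]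
  change _ ↔ (Matrix.of fun i j => f (Mstar i j)).rank = n
  rw [Matrix.rank_eq_iff_exists_det_submatrix_succAbove_ne_zero]
  simp only [ne_eq, hminor, ← not_forall]
  constructor
  · rintro ⟨u, hu, -, hgcd⟩ hall
    exact hFirr.not_isUnit (isUnit_of_dvd_unit (hgcd F hall) ((Ne.isUnit hu).map C))
  · intro hnot
    refine ⟨1, one_ne_zero, fun i => by simp, fun g hg => ?_⟩
    have hgdet : g ∣ C c * F ^ δ := by
      rw [← hMdet, Matrix.det_succ_column_zero]
      refine Finset.dvd_sum fun i _ => ?_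
      have hsub : M.submatrix i.succAbove Fin.succ = Mstar.submatrix i.succAbove id := by
        ext k j : 2
        simp [hMstar]
      refine Dvd.dvd.mul_left ?_ _
      have hgi := hg i
      rwa [hΔ, IsUnit.dvd_mul_left (isUnit_one.neg.pow _), ← hsub] at hgi
    rw [IsUnit.dvd_mul_left (hc.isUnit.map C), dvd_prime_pow hFirr.prime] at hgdet
    obtain ⟨k, -, hk⟩ := hgdet
    rcases k with _ | k
    · rw [C_1]
      simpa using hk.dvd
    · exact absurd (fun i => ((dvd_pow_self F k.succ_ne_zero).trans hk.dvd').trans (hg i)) hnot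
end

section
/- Lemma (the rank condition over the surface equals the rank condition after substitution). Given an implicitization-matrix datum for φ, the ideal (F) of K[X₁,X₂,X₃,X₄] is prime; let L denote the fraction field of the integral domain K[X₁,X₂,X₃,X₄]/(F). Then the d×(d−1) matrix obtained from M* by reducing all entries modulo (F), viewed over L, has rank d−1 if and only if the d×(d−1) matrix with entries M*_{ij}(p₁,p₂,p₃,p₄) ∈ K[t₁,t₂,t₃], viewed over the fraction field K(t₁,t₂,t₃), has rank d−1. -/
open MvPolynomial

/-- A matrix over a field has full column rank iff its columns are linearly independent. -/
theorem Matrix.rank_eq_card_iff_linearIndependent_col {m n R : Type*} [Finite m] [Fintype n]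
    [Field R] (A : Matrix m n R) :
    A.rank = Fintype.card n ↔ LinearIndependent R A.col := by
  rw [A.rank_eq_finrank_span_cols, linearIndependent_iff_card_eq_finrank_span, Set.finrank, eq_comm]

/-- For matrices over a commutative ring embedded in a field, having full column rank over the
field amounts to linear independence of the columns over the ring. -/
theorem Matrix.rank_map_eq_card_iff_linearIndependent_col {m n R S : Type*} [Finite m] [Fintype n]
    [CommRing R] [Field S] (f : R →+* S) (hf : Function.Injective f) (A : Matrix m n R) :
    (A.map f).rank = Fintype.card n ↔ LinearIndependent R A.col := by
  let : Algebra R S := f.toAlgebra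
  have : FaithfulSMul R S := (faithfulSMul_iff_algebraMap_injective R S).mpr hf
  rw [rank_eq_card_iff_linearIndependent_col]
  exact linearIndependent_algebraMap_comp_iff (R := R) (S := S) (v := A.col)

/-- the rank condition over the surface equals the rank condition after
substitution.  Given an implicitization-matrix datum for `φ`, the ideal `(F)` is prime;
letting `L` be the fraction field of the domain `K[X₁,X₂,X₃,X₄]/(F)`, the matrix obtained
from `M*` by reducing its entries modulo `(F)`, viewed over `L`, has rank `d - 1 = n` if
and only if the matrix with entries `M*ᵢⱼ(p₁,p₂,p₃,p₄)`, viewed over the fraction field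
`K(t₁,t₂,t₃)`, has rank `d - 1 = n`. -/
theorem rank_over_surface_iff_rank_after_substitution
    (K : Type*) [Field K] [CharZero K]
    (p : Fin 4 → MvPolynomial (Fin 3) K)
    (N : ℕ) (hN : 1 ≤ N) (hphom : ∀ i, (p i).IsHomogeneous N) (hp4 : p 3 ≠ 0)
    (F : MvPolynomial (Fin 4) K)
    (hFhom : ∃ D : ℕ, F.IsHomogeneous D) (hFirr : Irreducible F)
    (hFimp : ∀ G : MvPolynomial (Fin 4) K, aeval p G = 0 ↔ F ∣ G)
    (n : ℕ) (hn : 2 ≤ n) (m : ℕ) (hm : 1 ≤ m)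
    (α : Fin (n + 1) → (Fin 3 →₀ ℕ)) (hαinj : Function.Injective α)
    (hαdeg : ∀ i, (α i).sum (fun _ e => e) = m)
    (b : Fin 3 → Fin (n + 1))
    (hb1 : (X 0 : MvPolynomial (Fin 3) K) * monomial (α (b 2)) 1 =
      (X 2 : MvPolynomial (Fin 3) K) * monomial (α (b 0)) 1)
    (hb2 : (X 1 : MvPolynomial (Fin 3) K) * monomial (α (b 2)) 1 =
      (X 2 : MvPolynomial (Fin 3) K) * monomial (α (b 1)) 1)
    (M : Matrix (Fin (n + 1)) (Fin (n + 1)) (MvPolynomial (Fin 4) K))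
    (hcol0 : ∃ e : ℕ, 1 ≤ e ∧ ∀ i, (M i 0).IsHomogeneous e)
    (hcolhom : ∀ j : Fin n, ∃ dj : ℕ, 1 ≤ dj ∧ ∀ i, (M i j.succ).IsHomogeneous dj)
    (hcolmoving : ∀ j : Fin n,
      ∑ i : Fin (n + 1), (monomial (α i) (1 : K)) * (aeval p) (M i j.succ) = 0)
    (c : K) (hc : c ≠ 0) (δ : ℕ) (hδ : 1 ≤ δ)
    (hMdet : M.det = C c * F ^ δ)
    (Mstar : Matrix (Fin (n + 1)) (Fin n) (MvPolynomial (Fin 4) K))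
    (hMstar : ∀ i j, Mstar i j = M i j.succ)
    (Δ : Fin (n + 1) → MvPolynomial (Fin 4) K)
    (hΔ : ∀ i : Fin (n + 1),
      Δ i = (-1 : MvPolynomial (Fin 4) K) ^ (i : ℕ) *
        (Mstar.submatrix i.succAbove id).det)
    :
    (Ideal.span {F}).IsPrime ∧
      ((Matrix.of fun (i : Fin (n + 1)) (j : Fin n) =>
          algebraMap (MvPolynomial (Fin 4) K ⧸ Ideal.span {F})
            (FractionRing (MvPolynomial (Fin 4) K ⧸ Ideal.span {F}))
            (Ideal.Quotient.mk (Ideal.span {F}) (Mstar i j))).rank = n ↔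
        ((Mstar.map (aeval p)).map
          (algebraMap (MvPolynomial (Fin 3) K)
            (FractionRing (MvPolynomial (Fin 3) K)))).rank = n) := by
  have hprime : (Ideal.span {F}).IsPrime :=
    (Ideal.span_singleton_prime hFirr.ne_zero).mpr hFirr.prime
  refine ⟨hprime, ?_⟩
  let ψ : MvPolynomial (Fin 4) K ⧸ Ideal.span {F} →+* MvPolynomial (Fin 3) K :=
    Ideal.Quotient.lift _ (aeval p : _ →ₐ[K] _).toRingHom fun G hG =>
      (hFimp G).mpr (Ideal.mem_span_singleton.mp hG)
  have hψ : Function.Injective ψ :=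
    RingHom.lift_injective_of_ker_le_ideal _ _ fun G hG =>
      Ideal.mem_span_singleton.mpr ((hFimp G).mp hG)
  have hL := Matrix.rank_map_eq_card_iff_linearIndependent_col
    (algebraMap _ (FractionRing (MvPolynomial (Fin 4) K ⧸ Ideal.span {F})))
    (IsFractionRing.injective _ _) (Mstar.map (Ideal.Quotient.mk (Ideal.span {F})))
  have hK := Matrix.rank_map_eq_card_iff_linearIndependent_col
    ((algebraMap _ (FractionRing (MvPolynomial (Fin 3) K))).comp ψ)
    ((IsFractionRing.injective _ _).comp hψ) (Mstar.map (Ideal.Quotient.mk (Ideal.span {F})))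
  rw [Fintype.card_fin] at hL hK
  exact hL.trans hK.symm
end

section
/- Proposition (properness criterion for plane curve parameterizations). The parameterization is proper, i.e. K(φ₁,φ₂) = K(t), if and only if the gcd of Δ₁, …, Δ_{m+n} in K[x,y] is a nonzero constant of K. -/
/-- The rational function `p/q ∈ K(t)` associated to a pair of polynomials `p, q ∈ K[t]`. -/
noncomputable def ratCoord {K : Type*} [Field K] (p q : Polynomial K) : RatFunc K :=
  algebraMap (Polynomial K) (RatFunc K) p / algebraMap (Polynomial K) (RatFunc K) q

open Polynomial in
/-- Polynomials of degree less than `k`, given by coefficient vectors in descending order. -/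
noncomputable def descPoly {R : Type*} [CommRing R] {k : ℕ} (v : Fin k → R) : Polynomial R :=
  ∑ i, C (v i) * X ^ (i.rev : ℕ)

section
open Polynomial

theorem coeff_descPoly {R : Type*} [CommRing R] {k : ℕ} (v : Fin k → R) (i : Fin k) :
    (descPoly v).coeff (i.rev : ℕ) = v i := by
  simp only [descPoly, finsetSum_coeff, coeff_C_mul_X_pow]
  rw [Finset.sum_eq_single i]
  · simp
  · intro b _ hb
    rw [if_neg]
    intro h
    exact hb (Fin.rev_injective (Fin.ext h.symm))
  · simp

theorem descPoly_eq_zero_iff {R : Type*} [CommRing R] {k : ℕ} (v : Fin k → R) :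
    descPoly v = 0 ↔ v = 0 := by
  constructor
  · intro h
    ext i
    rw [← coeff_descPoly v i, h]
    simp
  · rintro rfl
    simp [descPoly]

theorem degree_descPoly_lt {R : Type*} [CommRing R] {k : ℕ} (v : Fin k → R) :
    (descPoly v).degree < k := by
  refine (degree_sum_le _ _).trans_lt ?_
  rw [Finset.sup_lt_iff (by simp)]
  intro i _
  exact (degree_C_mul_X_pow_le _ _).trans_lt (by exact_mod_cast i.rev.isLt)

theorem exists_descPoly_eq {R : Type*} [CommRing R] {k : ℕ} {p : Polynomial R}
    (hp : p.degree < k) : ∃ v : Fin k → R, descPoly v = p := by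
  refine ⟨fun i => p.coeff (i.rev : ℕ), ?_⟩
  ext j
  by_cases hj : j < k
  · simpa using coeff_descPoly (fun i : Fin k => p.coeff (i.rev : ℕ)) (Fin.rev ⟨j, hj⟩)
  · have h : ((k : ℕ) : WithBot ℕ) ≤ (j : ℕ) := by exact_mod_cast not_lt.mp hj
    rw [coeff_eq_zero_of_degree_lt (hp.trans_le h),
      coeff_eq_zero_of_degree_lt ((degree_descPoly_lt _).trans_le h)]

end

/-- An `(N+1) × N` matrix over a field has a nontrivial kernel iff its maximal minors vanish. -/
theorem Matrix.exists_mulVec_eq_zero_iff_maximal_minors {L : Type*} [Field L] {N : ℕ}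
    (A : Matrix (Fin (N + 1)) (Fin N) L) :
    (∃ v ≠ 0, A.mulVec v = 0) ↔ ∀ i : Fin (N + 1), (A.submatrix i.succAbove id).det = 0 := by
  constructor
  · rintro ⟨v, hv, hAv⟩ i
    refine Matrix.exists_mulVec_eq_zero_iff.mp ⟨v, hv, ?_⟩
    ext r
    exact congrFun hAv (i.succAbove r)
  · intro h
    obtain ⟨w, hw⟩ : ∃ w : Fin (N + 1) → L, w ∉ LinearMap.range A.mulVecLin := by
      by_contra! hw
      have hs : Function.Surjective A.mulVecLin := fun w => hw w
      have := LinearMap.finrank_le_finrank_of_surjective hs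
      simp at this
    let B : Matrix (Fin (N + 1)) (Fin (N + 1)) L :=
      Matrix.of fun r => Fin.snoc (α := fun _ => L) (A r) (w r)
    have hB : B.det = 0 := by
      rw [Matrix.det_succ_column B (Fin.last N)]
      refine Finset.sum_eq_zero fun i _ => ?_
      have : B.submatrix i.succAbove (Fin.last N).succAbove = A.submatrix i.succAbove id := by
        ext r c
        simp [B]
      rw [this, h i, mul_zero]
    obtain ⟨u, hu, hBu⟩ := Matrix.exists_mulVec_eq_zero_iff.mpr hB
    have key : A.mulVec (fun j => u j.castSucc) + u (Fin.last N) • w = 0 := by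
      rw [← hBu]
      ext r
      simp [B, Matrix.mulVec, dotProduct, Fin.sum_univ_castSucc, mul_comm]
    have hlast : u (Fin.last N) = 0 := by
      by_contra hc
      refine hw ⟨-(u (Fin.last N))⁻¹ • fun j => u j.castSucc, ?_⟩
      rw [Matrix.mulVecLin_apply, Matrix.mulVec_smul, eq_neg_of_add_eq_zero_left key]
      simp [smul_smul, inv_mul_cancel₀ hc]
    refine ⟨fun j => u j.castSucc, ?_, by simpa [hlast] using key⟩
    intro h0
    apply hu
    ext j
    induction j using Fin.lastCases with
    | last => exact hlast
    | cast j => exact congrFun h0 j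

section
open Polynomial

/-- The maximal minors of the truncated Sylvester matrix vanish iff there is a nontrivial
syzygy `a f + t b g = 0` with `deg a < n` and `deg b < m - 1`. -/
theorem minors_eq_zero_iff_exists_syzygy {L : Type*} [Field L] {n k : ℕ}
    (f g : Polynomial L) (S : Matrix (Fin (n + k + 1)) (Fin (n + k + 1)) L)
    (hS : ∀ i, descPoly (fun c => S c i) =
      if (i : ℕ) < n then X ^ (n - 1 - (i : ℕ)) * f else X ^ (n + k - (i : ℕ)) * g) :
    (∀ i : Fin (n + k + 1),
        (Matrix.of fun (r j : Fin (n + k)) => S (i.succAbove r) j.castSucc).det = 0) ↔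
      ∃ a b : Polynomial L, (a ≠ 0 ∨ b ≠ 0) ∧ a.degree < n ∧ b.degree < k ∧
        a * f + X * b * g = 0 := by
  let A : Matrix (Fin (n + k + 1)) (Fin (n + k)) L := Matrix.of fun r j => S r j.castSucc
  have hA : ∀ (v : Fin n → L) (w : Fin k → L),
      descPoly (A.mulVec (Fin.append v w)) = descPoly v * f + X * descPoly w * g := by
    intro v w
    have h1 : descPoly (A.mulVec (Fin.append v w)) =
        ∑ j, C (Fin.append v w j) * descPoly (fun c => S c j.castSucc) := by
      simp only [descPoly, Matrix.mulVec, dotProduct, A, Matrix.of_apply, map_sum,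
        Finset.sum_mul, Finset.mul_sum, map_mul]
      rw [Finset.sum_comm]
      refine Finset.sum_congr rfl fun j _ => Finset.sum_congr rfl fun c _ => by ring
    rw [h1, Fin.sum_univ_add]
    congr 1
    · rw [descPoly, Finset.sum_mul]
      refine Finset.sum_congr rfl fun i _ => ?_
      have hi : n - 1 - (i : ℕ) = (i.rev : ℕ) := by rw [Fin.val_rev]; omega
      rw [hS]
      simp [hi, mul_assoc]
    · rw [descPoly, Finset.mul_sum, Finset.sum_mul]
      refine Finset.sum_congr rfl fun i _ => ?_
      have hi : n + k - (n + (i : ℕ)) = (i.rev : ℕ) + 1 := by rw [Fin.val_rev]; omega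
      rw [hS]
      simp only [Fin.append_right, Fin.val_castSucc, Fin.val_natAdd, hi]
      rw [if_neg (by omega)]
      ring
  have hmin := Matrix.exists_mulVec_eq_zero_iff_maximal_minors A
  refine hmin.symm.trans ⟨?_, ?_⟩
  · rintro ⟨u, hu, hAu⟩
    obtain ⟨v, w, rfl⟩ : ∃ v w, u = Fin.append v w :=
      ⟨fun i => u (Fin.castAdd k i), fun i => u (Fin.natAdd n i), Fin.append_castAdd_natAdd.symm⟩
    refine ⟨descPoly v, descPoly w, ?_, degree_descPoly_lt v, degree_descPoly_lt w, ?_⟩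
    · by_contra! h
      rw [descPoly_eq_zero_iff, descPoly_eq_zero_iff] at h
      apply hu
      ext i
      refine Fin.addCases (fun i => ?_) (fun i => ?_) i <;> simp [h.1, h.2]
    · rw [← hA, hAu, descPoly_eq_zero_iff]
  · rintro ⟨a, b, hab, ha, hb, h⟩
    obtain ⟨v, rfl⟩ := exists_descPoly_eq ha
    obtain ⟨w, rfl⟩ := exists_descPoly_eq hb
    refine ⟨Fin.append v w, ?_, ?_⟩
    · intro h0
      rw [Ne, Ne, descPoly_eq_zero_iff, descPoly_eq_zero_iff] at hab
      rcases hab with hab | hab <;> apply hab <;> ext i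
      · simpa using congrFun h0 (Fin.castAdd k i)
      · simpa using congrFun h0 (Fin.natAdd n i)
    · rw [← descPoly_eq_zero_iff, hA, h]

end

section
open Polynomial

/-- The polynomial `p - x q` over an extension `L` of `K`, where `p, q ∈ K[t]` and `x ∈ L`. -/
noncomputable def pencil {K L : Type*} [Field K] [Field L] [Algebra K L] (p q : K[X]) (x : L) :
    L[X] :=
  p.map (algebraMap K L) - C x * q.map (algebraMap K L)

variable {K L : Type*} [Field K] [Field L] [Algebra K L] {p q : K[X]} {x τ : L}

theorem eval_pencil : (pencil p q x).eval τ = aeval τ p - x * aeval τ q := by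
  simp [pencil, eval_map_algebraMap]

theorem natDegree_pencil_le : (pencil p q x).natDegree ≤ max p.natDegree q.natDegree := by
  refine (natDegree_sub_le _ _).trans (max_le_max ?_ ?_)
  · exact natDegree_map_le
  · exact (natDegree_C_mul_le _ _).trans natDegree_map_le

theorem pencil_ne_zero (hcop : IsCoprime p q) (hd : 1 ≤ max p.natDegree q.natDegree) :
    pencil p q x ≠ 0 := by
  intro h
  have h' : p.map (algebraMap K L) = C x * q.map (algebraMap K L) := sub_eq_zero.mp h
  have hc : IsCoprime (p.map (algebraMap K L)) (q.map (algebraMap K L)) :=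
    (isCoprime_map _).mpr hcop
  have hu : IsUnit (q.map (algebraMap K L)) :=
    hc.isUnit_of_dvd' (h' ▸ dvd_mul_left _ _) dvd_rfl
  have hq : q.natDegree = 0 := by
    rw [← natDegree_map (algebraMap K L)]
    exact natDegree_eq_zero_of_isUnit hu
  have hp : p.natDegree ≤ q.natDegree := by
    rw [← natDegree_map (algebraMap K L), h', ← natDegree_map (p := q) (algebraMap K L)]
    exact natDegree_C_mul_le _ _
  omega

theorem aeval_ne_zero_of_eval_pencil_eq_zero (hcop : IsCoprime p q)
    (h : (pencil p q x).eval τ = 0) : aeval τ q ≠ 0 := by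
  intro hq
  rw [eval_pencil, hq, mul_zero, sub_zero] at h
  obtain ⟨a, b, hab⟩ := hcop
  simpa [h, hq] using congrArg (aeval τ) hab

theorem isAlgebraic_iff_of_eval_pencil_eq_zero (hcop : IsCoprime p q)
    (hd : 1 ≤ max p.natDegree q.natDegree) (h : (pencil p q x).eval τ = 0) :
    IsAlgebraic K τ ↔ IsAlgebraic K x := by
  constructor
  · intro hτ
    have := IntermediateField.isAlgebraic_adjoin_simple hτ.isIntegral
    have hmem : ∀ r : K[X], aeval τ r ∈ IntermediateField.adjoin K {τ} := fun r =>
      IntermediateField.algebra_adjoin_le_adjoin K _ (aeval_mem_adjoin_singleton K τ)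
    have hx : x = aeval τ p / aeval τ q := by
      rw [eq_div_iff (aeval_ne_zero_of_eval_pencil_eq_zero hcop h)]
      rw [eval_pencil] at h
      exact (sub_eq_zero.mp h).symm
    have hxm : x ∈ IntermediateField.adjoin K {τ} := hx ▸ div_mem (hmem p) (hmem q)
    exact IntermediateField.isAlgebraic_iff.mp (this.isAlgebraic ⟨x, hxm⟩)
  · intro hx
    have := IntermediateField.isAlgebraic_adjoin_simple hx.isIntegral
    refine IsAlgebraic.restrictScalars (S := IntermediateField.adjoin K {x}) K ?_
    refine ⟨pencil p q (IntermediateField.AdjoinSimple.gen K x), pencil_ne_zero hcop hd, ?_⟩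
    rw [eval_pencil] at h
    simpa [pencil] using h

theorem natDegree_pencil (hd : 1 ≤ max p.natDegree q.natDegree) (hx : Transcendental K x) :
    (pencil p q x).natDegree = max p.natDegree q.natDegree := by
  refine natDegree_eq_of_le_of_coeff_ne_zero natDegree_pencil_le ?_
  set M := max p.natDegree q.natDegree with hM
  intro h
  have h' : algebraMap K L (p.coeff M) = x * algebraMap K L (q.coeff M) := by
    simpa [pencil, sub_eq_zero] using h
  by_cases hq : q.coeff M = 0
  · have hp : p.coeff M = 0 := by simpa [hq] using h'
    rcases max_choice p.natDegree q.natDegree with hc | hc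
    · rw [← hM] at hc
      rw [hc, coeff_natDegree, leadingCoeff_eq_zero] at hp
      simp [hp] at hc
      omega
    · rw [← hM] at hc
      rw [hc, coeff_natDegree, leadingCoeff_eq_zero] at hq
      simp [hq] at hc
      omega
  · apply hx
    have hq' : algebraMap K L (q.coeff M) ≠ 0 := by simpa using hq
    have : x = algebraMap K L (p.coeff M / q.coeff M) := by
      rw [map_div₀, eq_div_iff hq', h']
    rw [this]
    exact isAlgebraic_algebraMap _

theorem eval_derivative_pencil_ne_zero [CharZero K] (hcop : IsCoprime p q)
    (hd : 1 ≤ max p.natDegree q.natDegree) (hτ : Transcendental K τ)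
    (h : (pencil p q x).eval τ = 0) : (derivative (pencil p q x)).eval τ ≠ 0 := by
  intro h'
  have h1 : aeval τ p = x * aeval τ q := by rwa [eval_pencil, sub_eq_zero] at h
  have h2 : aeval τ (derivative p) = x * aeval τ (derivative q) := by
    simpa [pencil, derivative_map, eval_map_algebraMap, sub_eq_zero] using h'
  have h3 : derivative p * q = p * derivative q := by
    rw [← sub_eq_zero]
    refine (transcendental_iff.mp hτ) _ ?_
    simp only [map_sub, map_mul, h1, h2]
    ring
  have key : ∀ r : K[X], r ∣ derivative r → r.natDegree = 0 := by
    intro r hr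
    by_contra hne
    have h0 : derivative r = 0 :=
      eq_zero_of_dvd_of_degree_lt hr (degree_derivative_lt (by rintro rfl; simp at hne))
    exact hne (derivative_eq_zero.mp h0)
  have hp := key p (hcop.dvd_of_dvd_mul_right (h3 ▸ dvd_mul_right _ _))
  have hq := key q (hcop.symm.dvd_of_dvd_mul_left (h3 ▸ dvd_mul_left _ _))
  omega

theorem eval_zero_pencil_ne_zero (hcop : IsCoprime p q)
    (hd : 1 ≤ max p.natDegree q.natDegree) (hx : Transcendental K x) :
    (pencil p q x).eval 0 ≠ 0 := fun h =>
  hx ((isAlgebraic_iff_of_eval_pencil_eq_zero hcop hd h).mp isAlgebraic_zero)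

theorem eval_pencil_ratCoord (hq : q ≠ 0) :
    (pencil p q (ratCoord p q)).eval (RatFunc.X : RatFunc K) = 0 := by
  have hq' : algebraMap K[X] (RatFunc K) q ≠ 0 := by simpa using hq
  rw [eval_pencil, ratCoord, RatFunc.aeval_X_left_eq_algebraMap,
    RatFunc.aeval_X_left_eq_algebraMap, div_mul_cancel₀ _ hq', sub_self]

end

section
open Polynomial

/-- The embedding of `K(t)` sending `t` to a transcendental element. -/
theorem RatFunc.exists_algHom_of_transcendental {K L : Type*} [Field K] [Field L] [Algebra K L]
    {τ : L} (hτ : Transcendental K τ) :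
    ∃ σ : RatFunc K →ₐ[K] L, ∀ p q : K[X], σ (ratCoord p q) = aeval τ p / aeval τ q := by
  have hinj : nonZeroDivisors K[X] ≤ (nonZeroDivisors L).comap (aeval (R := K) τ) := by
    refine nonZeroDivisors_le_comap_nonZeroDivisors_of_injective _ ?_
    exact transcendental_iff_injective.mp hτ
  exact ⟨RatFunc.liftAlgHom (aeval τ) hinj, fun p q => RatFunc.liftAlgHom_apply_div _ _ _ _⟩

variable {K L : Type*} [Field K] [Field L] [Algebra K L] {p₁ q₁ p₂ q₂ : K[X]} {x y : L}

/-- For a proper parameterization, a generic point of the curve has a unique parameter. -/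
theorem eq_of_eval_pencil_eq_zero
    (hproper : IntermediateField.adjoin K {ratCoord p₁ q₁, ratCoord p₂ q₂} = ⊤)
    (hcop₁ : IsCoprime p₁ q₁) (hcop₂ : IsCoprime p₂ q₂) {τ τ' : L}
    (hτ : Transcendental K τ) (hτ' : Transcendental K τ')
    (h₁ : (pencil p₁ q₁ x).eval τ = 0) (h₂ : (pencil p₂ q₂ y).eval τ = 0)
    (h₁' : (pencil p₁ q₁ x).eval τ' = 0) (h₂' : (pencil p₂ q₂ y).eval τ' = 0) : τ = τ' := by
  obtain ⟨σ, hσ⟩ := RatFunc.exists_algHom_of_transcendental hτ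
  obtain ⟨σ', hσ'⟩ := RatFunc.exists_algHom_of_transcendental hτ'
  have hdiv : ∀ {p q : K[X]} {z θ : L}, IsCoprime p q → (pencil p q z).eval θ = 0 →
      aeval θ p / aeval θ q = z := by
    intro p q z θ hc h
    rw [div_eq_iff (aeval_ne_zero_of_eval_pencil_eq_zero hc h)]
    rwa [eval_pencil, sub_eq_zero] at h
  have hext : σ.comp (⊤ : IntermediateField K (RatFunc K)).val =
      σ'.comp (⊤ : IntermediateField K (RatFunc K)).val := by
    refine IntermediateField.algHom_ext_of_eq_adjoin K hproper.symm ?_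
    rintro z (rfl | rfl)
    · simp [hσ, hσ', hdiv hcop₁ h₁, hdiv hcop₁ h₁']
    · simp [hσ, hσ', hdiv hcop₂ h₂, hdiv hcop₂ h₂']
  have hX : σ (ratCoord X 1) = σ' (ratCoord X 1) :=
    DFunLike.congr_fun hext ⟨ratCoord X 1, trivial⟩
  simpa [hσ, hσ'] using hX

theorem exists_common_root_of_syzygy [IsAlgClosed L] (f g : L[X]) {k : ℕ} {n : ℕ}
    (hdeg : f.natDegree = k + 1 ∨ g.natDegree = n) (hf : f ≠ 0) (hg : g ≠ 0)
    {a b : L[X]} (hab : a ≠ 0 ∨ b ≠ 0) (ha : a.degree < n) (hb : b.degree < k)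
    (h : a * f + X * b * g = 0) : ∃ τ, f.eval τ = 0 ∧ g.eval τ = 0 := by
  by_contra! hno
  have hc : IsCoprime f g := by
    rw [isCoprime_iff_aeval_ne_zero_of_isAlgClosed L L]
    intro τ
    by_contra! hτ
    exact hno τ (by simpa using hτ.1) (by simpa using hτ.2)
  have hX : (X : L[X]) ≠ 0 := X_ne_zero
  rcases hdeg with hd | hd
  · have hdvd : f ∣ X * b := by
      refine hc.dvd_of_dvd_mul_right ⟨-a, ?_⟩
      linear_combination h
    have hXb : X * b = 0 := by
      refine eq_zero_of_dvd_of_degree_lt hdvd ?_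
      by_cases hb0 : b = 0
      · simpa [hb0, bot_lt_iff_ne_bot] using hf
      rw [degree_eq_natDegree hf, degree_mul, degree_X, hd, degree_eq_natDegree hb0]
      rw [degree_eq_natDegree hb0] at hb
      norm_cast at hb ⊢
      omega
    rw [hXb, zero_mul, add_zero] at h
    simp_all
  · have hdvd : g ∣ a := by
      refine hc.symm.dvd_of_dvd_mul_right ⟨-(X * b), ?_⟩
      linear_combination h
    have ha0 : a = 0 := by
      refine eq_zero_of_dvd_of_degree_lt hdvd ?_
      rwa [degree_eq_natDegree hg, hd]
    simp_all

theorem no_syzygy_of_simple_common_root [IsAlgClosed L] {f g : L[X]} {k : ℕ} {τ : L}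
    (hτ₁ : f.eval τ = 0) (hτ₂ : g.eval τ = 0) (hder : (derivative f).eval τ ≠ 0)
    (hz : f.eval 0 ≠ 0) (hdf : f.natDegree = k + 1) (hf0 : f ≠ 0) (hg0 : g ≠ 0)
    (huniq : ∀ θ, f.eval θ = 0 → g.eval θ = 0 → θ = τ)
    {a b : L[X]} (hab : a ≠ 0 ∨ b ≠ 0) (hb : b.degree < k)
    (h : a * f + X * b * g = 0) : False := by
  obtain ⟨f₁, rfl⟩ := dvd_iff_isRoot.mpr hτ₁
  obtain ⟨g₁, rfl⟩ := dvd_iff_isRoot.mpr hτ₂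
  have hf₁τ : f₁.eval τ ≠ 0 := by simpa using hder
  have hf₁z : f₁.eval 0 ≠ 0 := by
    intro h0
    simp [h0] at hz
  have hf₁0 : f₁ ≠ 0 := right_ne_zero_of_mul hf0
  have hg₁0 : g₁ ≠ 0 := right_ne_zero_of_mul hg0
  have hcop : IsCoprime f₁ g₁ := by
    rw [isCoprime_iff_aeval_ne_zero_of_isAlgClosed L L]
    intro θ
    by_contra! hθ
    obtain ⟨h1, h2⟩ := hθ
    rw [coe_aeval_eq_eval] at h1 h2
    have := huniq θ (by simp [h1]) (by simp [h2])
    exact hf₁τ (this ▸ h1)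
  have hcopX : IsCoprime f₁ X := by
    rw [isCoprime_iff_aeval_ne_zero_of_isAlgClosed L L]
    intro θ
    by_contra! hθ
    obtain ⟨h1, h2⟩ := hθ
    rw [coe_aeval_eq_eval] at h1
    rw [aeval_X] at h2
    exact hf₁z (h2 ▸ h1)
  have hsyz : a * f₁ + X * b * g₁ = 0 := by
    refine (mul_eq_zero.mp (?_ : (X - C τ) * (a * f₁ + X * b * g₁) = 0)).resolve_left
      (X_sub_C_ne_zero τ)
    linear_combination h
  have hdvd : f₁ ∣ b := by
    refine hcopX.dvd_of_dvd_mul_left (hcop.dvd_of_dvd_mul_right ⟨-a, ?_⟩)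
    linear_combination hsyz
  have hdf₁ : f₁.natDegree = k := by
    rw [natDegree_mul (X_sub_C_ne_zero τ) hf₁0, natDegree_X_sub_C] at hdf
    omega
  have hb0 : b = 0 := by
    refine eq_zero_of_dvd_of_degree_lt hdvd ?_
    rwa [degree_eq_natDegree hf₁0, hdf₁]
  rw [hb0, mul_zero, zero_mul, add_zero] at hsyz
  exact hab.elim (fun ha => ha ((mul_eq_zero.mp hsyz).resolve_right hf₁0)) (fun hb1 => hb1 hb0)

/-- At a generic point of a properly parameterized curve there is no syzygy. -/
theorem no_syzygy_of_proper [CharZero K] [IsAlgClosed L]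
    (hproper : IntermediateField.adjoin K {ratCoord p₁ q₁, ratCoord p₂ q₂} = ⊤)
    (hcop₁ : IsCoprime p₁ q₁) (hcop₂ : IsCoprime p₂ q₂) {n k : ℕ}
    (hm : k + 1 = max p₁.natDegree q₁.natDegree) (hn : n = max p₂.natDegree q₂.natDegree)
    (hn1 : 1 ≤ n) (hxy : Transcendental K x ∨ Transcendental K y)
    {a b : L[X]} (hab : a ≠ 0 ∨ b ≠ 0) (ha : a.degree < n) (hb : b.degree < k)
    (h : a * pencil p₁ q₁ x + X * b * pencil p₂ q₂ y = 0) : False := by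
  have hd₁ : 1 ≤ max p₁.natDegree q₁.natDegree := by omega
  have hd₂ : 1 ≤ max p₂.natDegree q₂.natDegree := by omega
  have hf0 : pencil p₁ q₁ x ≠ 0 := pencil_ne_zero hcop₁ hd₁
  have hg0 : pencil p₂ q₂ y ≠ 0 := pencil_ne_zero hcop₂ hd₂
  obtain ⟨τ, hτ₁, hτ₂⟩ := exists_common_root_of_syzygy _ _
    (hxy.imp (fun hx => (natDegree_pencil hd₁ hx).trans hm.symm)
      (fun hy => (natDegree_pencil hd₂ hy).trans hn.symm)) hf0 hg0 hab ha hb h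
  have htr : ∀ {θ : L}, (pencil p₁ q₁ x).eval θ = 0 → (pencil p₂ q₂ y).eval θ = 0 →
      Transcendental K θ := by
    intro θ h₁ h₂ hθ
    rcases hxy with hx | hy
    · exact hx ((isAlgebraic_iff_of_eval_pencil_eq_zero hcop₁ hd₁ h₁).mp hθ)
    · exact hy ((isAlgebraic_iff_of_eval_pencil_eq_zero hcop₂ hd₂ h₂).mp hθ)
  have hτ := htr hτ₁ hτ₂
  have hx : Transcendental K x := fun hx =>
    hτ ((isAlgebraic_iff_of_eval_pencil_eq_zero hcop₁ hd₁ hτ₁).mpr hx)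
  have hder := eval_derivative_pencil_ne_zero hcop₁ hd₁ hτ hτ₁
  have hz := eval_zero_pencil_ne_zero hcop₁ hd₁ hx
  have hdf := (natDegree_pencil hd₁ hx).trans hm.symm
  have huniq : ∀ θ, (pencil p₁ q₁ x).eval θ = 0 → (pencil p₂ q₂ y).eval θ = 0 → θ = τ :=
    fun θ h₁ h₂ => eq_of_eval_pencil_eq_zero hproper hcop₁ hcop₂ (htr h₁ h₂) hτ h₁ h₂ hτ₁ hτ₂
  exact no_syzygy_of_simple_common_root hτ₁ hτ₂ hder hz hdf hf0 hg0 huniq hab hb h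

/-- A parameter generating a proper extension yields a syzygy. -/
theorem exists_syzygy_of_common_root {F E : Type*} [Field F] [Field E] [Algebra F E]
    {f g : F[X]} {n k : ℕ} (hf : f.natDegree ≤ k + 1) (hg : g.natDegree ≤ n)
    (hf0 : f ≠ 0) (hg0 : g ≠ 0) {t : E} (ht : t ∉ (algebraMap F E).range)
    (hft : aeval t f = 0) (hgt : aeval t g = 0) :
    ∃ a b : F[X], (a ≠ 0 ∨ b ≠ 0) ∧ a.degree < n ∧ b.degree < k ∧ a * f + X * b * g = 0 := by
  have hint : IsIntegral F t := (show IsAlgebraic F t from ⟨f, hf0, hft⟩).isIntegral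
  have h2 := (minpoly.two_le_natDegree_iff hint).mpr ht
  have hμ := minpoly.ne_zero hint
  obtain ⟨f₁, hf₁⟩ := minpoly.dvd F t hft
  obtain ⟨g₁, hg₁⟩ := minpoly.dvd F t hgt
  generalize minpoly F t = μ at *
  subst hf₁ hg₁
  have hf₁0 : f₁ ≠ 0 := right_ne_zero_of_mul hf0
  have hg₁0 : g₁ ≠ 0 := right_ne_zero_of_mul hg0
  rw [natDegree_mul hμ hf₁0] at hf
  rw [natDegree_mul hμ hg₁0] at hg
  refine ⟨X * g₁, -f₁, Or.inr (neg_ne_zero.mpr hf₁0), ?_, ?_, by ring⟩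
  · rw [degree_mul, degree_X, degree_eq_natDegree hg₁0]
    norm_cast
    omega
  · rw [degree_neg, degree_eq_natDegree hf₁0]
    norm_cast
    omega

end

section
open MvPolynomial

theorem MvPolynomial.eq_C_of_degreeOf_eq_zero {σ K : Type*} [CommSemiring K]
    {h : MvPolynomial σ K} (hd : ∀ i, h.degreeOf i = 0) : ∃ c, h = C c := by
  refine ⟨_, totalDegree_eq_zero_iff_eq_C.mp ?_⟩
  rw [totalDegree_eq_zero_iff]
  intro m hm i
  exact Nat.le_zero.mp ((monomial_le_degreeOf i hm).trans (hd i).le)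

/-- An irreducible bivariate polynomial does not divide both nonzero polynomials in the first
variable and nonzero polynomials in the second variable. -/
theorem transcendental_of_irreducible {K L : Type*} [Field K] [Field L] [Algebra K L]
    {h : MvPolynomial (Fin 2) K} (hirr : Irreducible h) (ρ : MvPolynomial (Fin 2) K →ₐ[K] L)
    (hρ : ∀ r, ρ r = 0 → h ∣ r) :
    Transcendental K (ρ (X 0)) ∨ Transcendental K (ρ (X 1)) := by
  by_contra! hc
  have key : ∀ i j : Fin 2, i ≠ j → IsAlgebraic K (ρ (X i)) → h.degreeOf j = 0 := by
    rintro i j hij ⟨P, hP0, hP⟩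
    rw [Polynomial.aeval_algHom_apply] at hP
    obtain ⟨s, hs⟩ := hρ _ hP
    have hne : Polynomial.aeval (X i : MvPolynomial (Fin 2) K) P ≠ 0 := by
      intro h0
      exact hP0 (transcendental_iff.mp (MvPolynomial.transcendental_X K i) P h0)
    have hdeg : (Polynomial.aeval (X i : MvPolynomial (Fin 2) K) P).degreeOf j = 0 := by
      rw [Polynomial.aeval_eq_sum_range, ← Nat.le_zero]
      refine (degreeOf_sum_le j _ _).trans (Finset.sup_le fun c _ => ?_)
      rw [smul_eq_C_mul]
      refine (degreeOf_C_mul_le _ j _).trans ?_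
      refine (degreeOf_pow_le _ _ _).trans ?_
      rw [degreeOf_X_of_ne hij.symm, mul_zero]
    rw [hs] at hne
    rw [hs, degreeOf_mul_eq (left_ne_zero_of_mul hne) (right_ne_zero_of_mul hne)] at hdeg
    omega
  simp only [Transcendental, not_not] at hc
  obtain ⟨c, rfl⟩ := MvPolynomial.eq_C_of_degreeOf_eq_zero (h := h) (by
    intro j
    fin_cases j
    · exact key 1 0 (by decide) hc.2
    · exact key 0 1 (by decide) hc.1)
  refine hirr.not_isUnit ((IsUnit.mk0 c ?_).map C)
  rintro rfl
  exact hirr.ne_zero (map_zero C)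

/-- The kernel of a generic point on a curve is generated by an irreducible polynomial. -/
theorem exists_irreducible_dvd_of_transcendental {K F : Type*} [Field K] [Field F] [Algebra K F]
    (ρ : MvPolynomial (Fin 2) K →ₐ[K] F) (hx : Transcendental K (ρ (X 0)))
    {r₀ : MvPolynomial (Fin 2) K} (hr₀ : r₀ ≠ 0) (hr₀' : ρ r₀ = 0) :
    ∃ h : MvPolynomial (Fin 2) K, Irreducible h ∧ ∀ r, ρ r = 0 → h ∣ r := by
  have hP : (RingHom.ker ρ).IsPrime := RingHom.ker_isPrime ρ
  obtain ⟨h, hhP, hh⟩ := hP.exists_mem_prime_of_ne_bot (by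
    intro hbot
    have : r₀ ∈ RingHom.ker ρ := hr₀'
    rw [hbot] at this
    exact hr₀ this)
  refine ⟨h, hh.irreducible, fun r hr => ?_⟩
  by_contra hdvd
  have hI : (Ideal.span {h}).IsPrime := (Ideal.span_singleton_prime hh.ne_zero).mpr hh
  have h01 : ⊥ < Ideal.span {h} := by
    rw [bot_lt_iff_ne_bot, Ne, Ideal.span_singleton_eq_bot]
    exact hh.ne_zero
  have h12 : Ideal.span {h} < RingHom.ker ρ := by
    refine lt_of_le_of_ne ((Ideal.span_singleton_le_iff_mem _).mpr hhP) ?_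
    intro heq
    have : r ∈ RingHom.ker ρ := hr
    rw [← heq, Ideal.mem_span_singleton] at this
    exact hdvd this
  obtain ⟨M, hM, hle⟩ := Ideal.exists_le_maximal _ hP.ne_top
  have h23 : RingHom.ker ρ < M := by
    refine lt_of_le_of_ne hle ?_
    rintro rfl
    let _ := Ideal.Quotient.field (RingHom.ker ρ)
    have hfin : Module.Finite K (MvPolynomial (Fin 2) K ⧸ RingHom.ker ρ) :=
      finite_of_finite_type_of_isJacobsonRing _ _
    have hint : IsIntegral K (Ideal.Quotient.mk (RingHom.ker ρ) (X 0)) :=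
      Algebra.IsIntegral.isIntegral _
    have := hint.map (Ideal.kerLiftAlg ρ : _ →ₐ[K] F)
    exact hx this.isAlgebraic
  have hM' := hM.isPrime
  have hb : (⊥ : Ideal (MvPolynomial (Fin 2) K)).IsPrime := Ideal.isPrime_bot
  have e1 := Ideal.height_add_one_le_of_lt_of_isPrime h01
  have e2 := Ideal.height_add_one_le_of_lt_of_isPrime h12
  have e3 := Ideal.height_add_one_le_of_lt_of_isPrime h23
  have e4 : ((M.height : ℕ∞) : WithBot ℕ∞) ≤ ringKrullDim (MvPolynomial (Fin 2) K) :=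
    Ideal.height_le_ringKrullDim_of_isPrime
  have e5 : ringKrullDim (MvPolynomial (Fin 2) K) = ((2 : ℕ∞) : WithBot ℕ∞) := by
    rw [MvPolynomial.ringKrullDim_of_isNoetherianRing, ringKrullDim_eq_zero_of_field]
    simp
  rw [e5, WithBot.coe_le_coe] at e4
  have e6 : (3 : ℕ∞) ≤ 2 := by
    calc (3 : ℕ∞) = 0 + 1 + 1 + 1 := by norm_num
      _ ≤ (⊥ : Ideal (MvPolynomial (Fin 2) K)).height + 1 + 1 + 1 := by gcongr; exact zero_le
      _ ≤ M.height := by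
        refine le_trans ?_ e3
        gcongr
        refine le_trans ?_ e2
        gcongr
      _ ≤ 2 := e4
  exact absurd e6 (by decide)

end

section
open Polynomial

variable {K : Type*} [Field K] {p₁ q₁ p₂ q₂ : K[X]}

theorem map_eq_pencil {L : Type*} [Field L] [Algebra K L]
    (ρ : MvPolynomial (Fin 2) K →ₐ[K] L) (p q : K[X]) (i : Fin 2) :
    (p.map (algebraMap K (MvPolynomial (Fin 2) K)) -
      C (MvPolynomial.X i) * q.map (algebraMap K (MvPolynomial (Fin 2) K))).map
        (ρ : MvPolynomial (Fin 2) K →+* L) = pencil p q (ρ (MvPolynomial.X i)) := by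
  have hρ : (ρ : MvPolynomial (Fin 2) K →+* L).comp (algebraMap K _) = algebraMap K L :=
    ρ.comp_algebraMap
  rw [Polynomial.map_sub, Polynomial.map_mul, Polynomial.map_map, Polynomial.map_map, hρ, map_C]
  rfl

/-- The minors of the truncated Sylvester matrix vanish at a point of the plane iff the
specialized polynomials admit a syzygy. -/
theorem map_minors_eq_zero_iff {L : Type*} [Field L] [Algebra K L] {n k : ℕ}
    (ρ : MvPolynomial (Fin 2) K →ₐ[K] L)
    {S : Matrix (Fin (n + k + 1)) (Fin (n + k + 1)) (MvPolynomial (Fin 2) K)}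
    (hS : ∀ i, descPoly (fun c => S c i) =
      if (i : ℕ) < n then
        X ^ (n - 1 - (i : ℕ)) * (p₁.map (algebraMap K (MvPolynomial (Fin 2) K)) -
          C (MvPolynomial.X 0) * q₁.map (algebraMap K (MvPolynomial (Fin 2) K)))
      else
        X ^ (n + k - (i : ℕ)) * (p₂.map (algebraMap K (MvPolynomial (Fin 2) K)) -
          C (MvPolynomial.X 1) * q₂.map (algebraMap K (MvPolynomial (Fin 2) K)))) :
    (∀ i : Fin (n + k + 1), ρ
        (Matrix.of fun (r j : Fin (n + k)) => S (i.succAbove r) j.castSucc).det = 0) ↔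
      ∃ a b : L[X], (a ≠ 0 ∨ b ≠ 0) ∧ a.degree < n ∧ b.degree < k ∧
        a * pencil p₁ q₁ (ρ (MvPolynomial.X 0)) +
          X * b * pencil p₂ q₂ (ρ (MvPolynomial.X 1)) = 0 := by
  rw [← minors_eq_zero_iff_exists_syzygy (n := n) (k := k) _ _ (S.map ρ) ?_]
  · refine forall_congr' fun i => ?_
    rw [AlgHom.map_det]
    rfl
  · intro i
    have := congrArg (Polynomial.map (ρ : MvPolynomial (Fin 2) K →+* L)) (hS i)
    rw [apply_ite (Polynomial.map (ρ : MvPolynomial (Fin 2) K →+* L)), Polynomial.map_mul,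
      Polynomial.map_mul, map_eq_pencil, map_eq_pencil] at this
    simpa [descPoly, Polynomial.map_sum] using this

end

/-- properness criterion for plane curve parameterizations.
Let `φ₁ = p₁/q₁`, `φ₂ = p₂/q₂` parameterize a plane curve, let `S` be the Sylvester matrix
of `f = p₁ - x·q₁` and `g = p₂ - y·q₂` (in degrees `m, n` with respect to `t`), let `𝕄` be
`S` with its last column deleted, and let `Δᵢ` be the signed maximal minors of `𝕄`.  Then
the parameterization is proper, i.e. `K(φ₁,φ₂) = K(t)`, if and only if the gcd of
`Δ₁, …, Δ_{m+n}` is a nonzero constant of `K`. -/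
theorem curve_proper_iff_gcd_of_minors_isUnit
    (K : Type*) [Field K] [CharZero K]
    (p₁ q₁ p₂ q₂ : Polynomial K)
    (hq₁ : q₁ ≠ 0) (hq₂ : q₂ ≠ 0)
    (hcop₁ : IsCoprime p₁ q₁) (hcop₂ : IsCoprime p₂ q₂)
    (m n : ℕ)
    (hm : m = max p₁.natDegree q₁.natDegree) (hm1 : 1 ≤ m)
    (hn : n = max p₂.natDegree q₂.natDegree) (hn1 : 1 ≤ n)
    (N : ℕ) (hN : m + n = N + 1)
    (f g : Polynomial (MvPolynomial (Fin 2) K))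
    (hf : f = p₁.map (algebraMap K (MvPolynomial (Fin 2) K)) -
      Polynomial.C (MvPolynomial.X 0) * q₁.map (algebraMap K (MvPolynomial (Fin 2) K)))
    (hg : g = p₂.map (algebraMap K (MvPolynomial (Fin 2) K)) -
      Polynomial.C (MvPolynomial.X 1) * q₂.map (algebraMap K (MvPolynomial (Fin 2) K)))
    (S : Matrix (Fin (N + 1)) (Fin (N + 1)) (MvPolynomial (Fin 2) K))
    (hS : ∀ i : Fin (N + 1),
      (∑ c : Fin (N + 1), Polynomial.C (S c i) *
          (Polynomial.X : Polynomial (MvPolynomial (Fin 2) K)) ^ (N - (c : ℕ))) =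
        if (i : ℕ) < n then Polynomial.X ^ (n - 1 - (i : ℕ)) * f
        else Polynomial.X ^ (m + n - 1 - (i : ℕ)) * g)
    (Δ : Fin (N + 1) → MvPolynomial (Fin 2) K)
    (hΔ : ∀ i : Fin (N + 1),
      Δ i = (-1 : MvPolynomial (Fin 2) K) ^ (i : ℕ) *
        (Matrix.of fun (r : Fin N) (j : Fin N) => S (i.succAbove r) j.castSucc).det)
    :
    IntermediateField.adjoin K {ratCoord p₁ q₁, ratCoord p₂ q₂} = ⊤ ↔
      ∃ u : K, u ≠ 0 ∧ (∀ i, (MvPolynomial.C u : MvPolynomial (Fin 2) K) ∣ Δ i) ∧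
        (∀ h : MvPolynomial (Fin 2) K, (∀ i, h ∣ Δ i) → h ∣ MvPolynomial.C u) := by
  obtain ⟨k, rfl⟩ : ∃ k, m = k + 1 := ⟨m - 1, by omega⟩
  obtain rfl : N = n + k := by omega
  have hd₁ : 1 ≤ max p₁.natDegree q₁.natDegree := hm ▸ hm1
  have hd₂ : 1 ≤ max p₂.natDegree q₂.natDegree := hn ▸ hn1
  have hS' : ∀ i, descPoly (fun c => S c i) =
      if (i : ℕ) < n then Polynomial.X ^ (n - 1 - (i : ℕ)) * f
      else Polynomial.X ^ (n + k - (i : ℕ)) * g := by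
    intro i
    have hexp : k + 1 + n - 1 - (i : ℕ) = n + k - (i : ℕ) := by omega
    have hi := hS i
    rw [hexp] at hi
    rw [← hi, descPoly]
    refine Finset.sum_congr rfl fun c _ => ?_
    rw [Fin.val_rev, Nat.add_sub_add_right]
  subst hf hg
  have hΔdvd : ∀ h i, h ∣ Δ i ↔ h ∣
      (Matrix.of fun (r j : Fin (n + k)) => S (i.succAbove r) j.castSucc).det := by
    intro h i
    rw [hΔ]
    exact ((isUnit_one.neg.pow _).dvd_mul_left)
  have hΔzero : ∀ i, Δ i = 0 ↔
      (Matrix.of fun (r j : Fin (n + k)) => S (i.succAbove r) j.castSucc).det = 0 := by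
    intro i
    simp only [← zero_dvd_iff, hΔdvd]
  constructor
  · intro hproper
    refine ⟨1, one_ne_zero, fun i => by simp, fun h hh => ?_⟩
    rw [map_one, ← isUnit_iff_dvd_one]
    by_contra hu
    obtain ⟨d, hd, hdΔ⟩ : ∃ d, Irreducible d ∧ ∀ i, d ∣ Δ i := by
      by_cases h0 : h = 0
      · refine ⟨MvPolynomial.X 0, (MvPolynomial.X_prime (i := 0)).irreducible, fun i => ?_⟩
        have := hh i
        rw [h0, zero_dvd_iff] at this
        exact this ▸ dvd_zero _
      · obtain ⟨d, hd, hdh⟩ := WfDvdMonoid.exists_irreducible_factor hu h0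
        exact ⟨d, hd, fun i => hdh.trans (hh i)⟩
    have hprime : (Ideal.span {d}).IsPrime :=
      (Ideal.span_singleton_prime hd.ne_zero).mpr hd.prime
    let Q := MvPolynomial (Fin 2) K ⧸ Ideal.span {d}
    let L := AlgebraicClosure (FractionRing Q)
    let ρ : MvPolynomial (Fin 2) K →ₐ[K] L :=
      (IsScalarTower.toAlgHom K Q L).comp (Ideal.Quotient.mkₐ K (Ideal.span {d}))
    have hinj : Function.Injective (algebraMap Q L) := by
      rw [IsScalarTower.algebraMap_eq Q (FractionRing Q) L]
      exact (algebraMap (FractionRing Q) L).injective.comp (IsFractionRing.injective Q _)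
    have hker : ∀ r, ρ r = 0 ↔ d ∣ r := by
      intro r
      rw [← Ideal.mem_span_singleton, ← Ideal.Quotient.eq_zero_iff_mem]
      exact map_eq_zero_iff _ hinj
    have : CharZero L := charZero_of_injective_algebraMap (algebraMap K L).injective
    obtain ⟨a, b, hab, ha, hb, hsyz⟩ := (map_minors_eq_zero_iff ρ hS').mp
      fun i => (hker _).mpr ((hΔdvd d i).mp (hdΔ i))
    exact no_syzygy_of_proper hproper hcop₁ hcop₂ hm hn hn1
      (transcendental_of_irreducible hd ρ fun r => (hker r).mp) hab ha hb hsyz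
  · rintro ⟨u, hu, -, hgcd⟩
    by_contra hproper
    let F := IntermediateField.adjoin K {ratCoord p₁ q₁, ratCoord p₂ q₂}
    let φ₁ : F := ⟨ratCoord p₁ q₁, IntermediateField.subset_adjoin K _ (by simp)⟩
    let φ₂ : F := ⟨ratCoord p₂ q₂, IntermediateField.subset_adjoin K _ (by simp)⟩
    let ρ : MvPolynomial (Fin 2) K →ₐ[K] F := MvPolynomial.aeval ![φ₁, φ₂]
    have hρ0 : ρ (MvPolynomial.X 0) = φ₁ := by simp [ρ]
    have hρ1 : ρ (MvPolynomial.X 1) = φ₂ := by simp [ρ]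
    have hX : (RatFunc.X : RatFunc K) ∉ (algebraMap F (RatFunc K)).range := by
      rintro ⟨z, hz⟩
      apply hproper
      rw [eq_top_iff, ← RatFunc.adjoin_X, IntermediateField.adjoin_le_iff,
        Set.singleton_subset_iff]
      exact hz ▸ z.2
    have hroot : ∀ {p q : Polynomial K} (z : F), q ≠ 0 → (z : RatFunc K) = ratCoord p q →
        Polynomial.aeval (RatFunc.X : RatFunc K) (pencil p q z) = 0 := by
      intro p q z hq hz
      have := eval_pencil_ratCoord (p := p) hq
      rw [← hz, eval_pencil] at this
      simpa [pencil] using this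
    have hzero := (map_minors_eq_zero_iff ρ hS').mpr (exists_syzygy_of_common_root
      (natDegree_pencil_le.trans hm.ge) (natDegree_pencil_le.trans hn.ge)
      (pencil_ne_zero hcop₁ hd₁) (pencil_ne_zero hcop₂ hd₂) hX
      (hroot _ hq₁ (by rw [hρ0])) (hroot _ hq₂ (by rw [hρ1])))
    have htr : Transcendental K (ρ (MvPolynomial.X 0)) := by
      rw [hρ0]
      intro hφ
      exact RatFunc.transcendental_X ((isAlgebraic_iff_of_eval_pencil_eq_zero hcop₁ hd₁
        (eval_pencil_ratCoord hq₁)).mpr (IntermediateField.isAlgebraic_iff.mp hφ))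
    have hCu : (MvPolynomial.C u : MvPolynomial (Fin 2) K) ≠ 0 := by simpa using hu
    obtain ⟨i, hi⟩ : ∃ i, Δ i ≠ 0 := by
      by_contra! h
      exact hCu (zero_dvd_iff.mp (hgcd 0 fun i => by rw [h i]))
    obtain ⟨d, hd, hdvd⟩ := exists_irreducible_dvd_of_transcendental ρ htr
      (mt (hΔzero i).mpr hi) (hzero i)
    exact hd.not_isUnit (isUnit_of_dvd_unit
      (hgcd d fun i => (hΔdvd d i).mpr (hdvd _ (hzero i))) ((IsUnit.mk0 u hu).map MvPolynomial.C))
end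

section
/- Proposition (inversion formulas for proper plane curve parameterizations). If the parameterization is proper, i.e. K(φ₁,φ₂) = K(t), then for every 1 ≤ i ≤ m+n−1 one has Δ_{i+1}(φ₁,φ₂) ≠ 0 in K(t) and Δᵢ(φ₁,φ₂) = t·Δ_{i+1}(φ₁,φ₂), where Δⱼ(φ₁,φ₂) denotes the image of Δⱼ ∈ K[x,y] under the K-algebra homomorphism K[x,y] → K(t) sending x ↦ φ₁ and y ↦ φ₂; in other words, the rational map (x,y) ↦ Δᵢ/Δ_{i+1} is an inversion of the parameterization. -/
open Polynomial in
theorem transcendental_ratCoord {K : Type*} [Field K] {p q : K[X]} (hq : q ≠ 0)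
    (hpq : IsCoprime p q) (hdeg : 1 ≤ max p.natDegree q.natDegree) :
    Transcendental K (ratCoord p q) := by
  apply RatFunc.transcendental_of_ne_C
  rintro ⟨c, hc⟩
  have hq' : algebraMap K[X] (RatFunc K) q ≠ 0 := RatFunc.algebraMap_ne_zero hq
  rw [ratCoord, div_eq_iff hq', ← RatFunc.algebraMap_C, ← map_mul] at hc
  have hp : p = C c * q := RatFunc.algebraMap_injective K hc
  have hu : IsUnit q := hpq.isUnit_of_dvd' (hp ▸ dvd_mul_left q (C c)) dvd_rfl
  have h0 : q.natDegree = 0 := natDegree_eq_zero_of_isUnit hu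
  have h1 : p.natDegree ≤ q.natDegree := hp ▸ natDegree_C_mul_le c q
  have := max_le h1 le_rfl
  omega

/-- The polynomial `p - φ q` over `K(t)`, where `φ = p/q`: its roots form the fibre of `φ` through
the generic point `t`. -/
noncomputable def fibrePoly {K : Type*} [Field K] (p q : Polynomial K) :
    Polynomial (RatFunc K) :=
  p.map (algebraMap K (RatFunc K)) - Polynomial.C (ratCoord p q) * q.map (algebraMap K (RatFunc K))

section fibrePoly

open Polynomial

variable {K : Type*} [Field K] {p q : K[X]}

theorem coeff_fibrePoly (p q : K[X]) (k : ℕ) : (fibrePoly p q).coeff k =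
    algebraMap K (RatFunc K) (p.coeff k) -
      ratCoord p q * algebraMap K (RatFunc K) (q.coeff k) := by
  simp [fibrePoly]

theorem coeff_fibrePoly_eq_zero_iff (h : Transcendental K (ratCoord p q)) (k : ℕ) :
    (fibrePoly p q).coeff k = 0 ↔ p.coeff k = 0 ∧ q.coeff k = 0 := by
  rw [coeff_fibrePoly]
  refine ⟨fun hk => ?_, fun hk => by simp [hk.1, hk.2]⟩
  have hq0 : q.coeff k = 0 := by
    by_contra hne
    refine h ?_
    have hne' : algebraMap K (RatFunc K) (q.coeff k) ≠ 0 := by simpa using hne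
    rw [(eq_div_iff hne').2 (sub_eq_zero.1 hk).symm, ← map_div₀]
    exact isAlgebraic_algebraMap _
  refine ⟨?_, hq0⟩
  simpa [hq0] using hk

theorem natDegree_fibrePoly (h : Transcendental K (ratCoord p q)) :
    (fibrePoly p q).natDegree = max p.natDegree q.natDegree := by
  apply le_antisymm
  · refine natDegree_le_iff_coeff_eq_zero.2 fun k hk => ?_
    rw [coeff_fibrePoly_eq_zero_iff h]
    exact ⟨coeff_eq_zero_of_natDegree_lt (lt_of_le_of_lt (le_max_left _ _) hk),
      coeff_eq_zero_of_natDegree_lt (lt_of_le_of_lt (le_max_right _ _) hk)⟩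
  · refine max_le ?_ ?_
    · by_cases hp : p = 0
      · simp [hp]
      · refine le_natDegree_of_ne_zero fun h0 => hp ?_
        exact leadingCoeff_eq_zero.1 ((coeff_fibrePoly_eq_zero_iff h _).1 h0).1
    · by_cases hq : q = 0
      · simp [hq]
      · refine le_natDegree_of_ne_zero fun h0 => hq ?_
        exact leadingCoeff_eq_zero.1 ((coeff_fibrePoly_eq_zero_iff h _).1 h0).2

theorem coeff_zero_fibrePoly_ne_zero (hpq : IsCoprime p q)
    (h : Transcendental K (ratCoord p q)) : (fibrePoly p q).coeff 0 ≠ 0 := by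
  rw [Ne, coeff_fibrePoly_eq_zero_iff h]
  rintro ⟨h1, h2⟩
  exact not_isUnit_X (hpq.isUnit_of_dvd' (X_dvd_iff.2 h1) (X_dvd_iff.2 h2))

theorem eval_X_map_algebraMap (p : K[X]) :
    (p.map (algebraMap K (RatFunc K))).eval RatFunc.X = algebraMap K[X] (RatFunc K) p := by
  rw [eval_map_algebraMap, ← RatFunc.algebraMap_X, aeval_algebraMap_apply, aeval_X_left_apply]

theorem eval_X_fibrePoly (hq : q ≠ 0) : (fibrePoly p q).eval RatFunc.X = 0 := by
  have hq' : algebraMap K[X] (RatFunc K) q ≠ 0 := RatFunc.algebraMap_ne_zero hq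
  rw [fibrePoly, eval_sub, eval_mul, eval_C, eval_X_map_algebraMap, eval_X_map_algebraMap,
    ratCoord, div_mul_cancel₀ _ hq', sub_self]

theorem eval_X_derivative_fibrePoly_ne_zero [CharZero K] (hq : q ≠ 0) (hpq : IsCoprime p q)
    (hdeg : 1 ≤ max p.natDegree q.natDegree) :
    (derivative (fibrePoly p q)).eval RatFunc.X ≠ 0 := by
  have hq' : algebraMap K[X] (RatFunc K) q ≠ 0 := RatFunc.algebraMap_ne_zero hq
  intro h
  rw [fibrePoly, derivative_sub, derivative_C_mul, derivative_map, derivative_map, eval_sub,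
    eval_mul, eval_C, eval_X_map_algebraMap, eval_X_map_algebraMap, ratCoord, sub_eq_zero,
    div_mul_eq_mul_div, eq_div_iff hq', ← map_mul, ← map_mul] at h
  have h' : derivative p * q = p * derivative q := RatFunc.algebraMap_injective K h
  have hdq : derivative q = 0 :=
    dvd_derivative_iff.1 (hpq.symm.dvd_of_dvd_mul_left (h' ▸ dvd_mul_left q _))
  have hdp : derivative p = 0 :=
    dvd_derivative_iff.1 (hpq.dvd_of_dvd_mul_right (h'.symm ▸ dvd_mul_right p _))
  have h1 := derivative_eq_zero.1 hdq
  have h2 := derivative_eq_zero.1 hdp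
  omega

theorem ratCoord_eq_of_aeval_fibrePoly_eq_zero {E : Type*} [Field E] [Algebra K E]
    [Algebra (RatFunc K) E] [IsScalarTower K (RatFunc K) E] (hpq : IsCoprime p q) {α : E}
    (hα : aeval α (fibrePoly p q) = 0) :
    aeval α q ≠ 0 ∧ algebraMap (RatFunc K) E (ratCoord p q) = aeval α p / aeval α q := by
  have h : aeval α p = algebraMap (RatFunc K) E (ratCoord p q) * aeval α q := by
    rwa [fibrePoly, map_sub, map_mul, aeval_C, aeval_map_algebraMap, aeval_map_algebraMap,
      sub_eq_zero] at hα
  have hne : aeval α q ≠ 0 := by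
    intro h0
    obtain ⟨a, b, hab⟩ := hpq
    have := congrArg (aeval α) hab
    simp [h, h0] at this
  exact ⟨hne, (eq_div_iff hne).2 h.symm⟩

/-- If `K(φ₁, φ₂) = K(t)`, the only common root of `p₁ - φ₁ q₁` and `p₂ - φ₂ q₂` is `t`. -/
theorem eq_X_of_aeval_fibrePoly_eq_zero {p₁ q₁ p₂ q₂ : K[X]} (hpq₁ : IsCoprime p₁ q₁)
    (hpq₂ : IsCoprime p₂ q₂) (htr : Transcendental K (ratCoord p₁ q₁))
    (hproper : IntermediateField.adjoin K {ratCoord p₁ q₁, ratCoord p₂ q₂} = ⊤)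
    {E : Type*} [Field E] [Algebra K E] [Algebra (RatFunc K) E] [IsScalarTower K (RatFunc K) E]
    {α : E} (h₁ : aeval α (fibrePoly p₁ q₁) = 0) (h₂ : aeval α (fibrePoly p₂ q₂) = 0) :
    α = algebraMap (RatFunc K) E RatFunc.X := by
  obtain ⟨hne₁, hφ₁⟩ := ratCoord_eq_of_aeval_fibrePoly_eq_zero hpq₁ h₁
  obtain ⟨hne₂, hφ₂⟩ := ratCoord_eq_of_aeval_fibrePoly_eq_zero hpq₂ h₂
  have hα : Transcendental K α := by
    intro halg
    apply (transcendental_algebraMap_iff (algebraMap (RatFunc K) E).injective).2 htr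
    have hint (r : K[X]) : IsIntegral K (aeval α r) :=
      adjoin_le_integralClosure halg.isIntegral (aeval_mem_adjoin_singleton K α)
    rw [hφ₁, div_eq_mul_inv]
    exact (hint p₁).isAlgebraic.mul (hint q₁).isAlgebraic.inv
  let σ : RatFunc K →ₐ[K] E := IsFractionRing.liftAlgHom (transcendental_iff_injective.1 hα)
  have hσ (r : K[X]) : σ (algebraMap K[X] (RatFunc K) r) = aeval α r :=
    IsFractionRing.lift_algebraMap (transcendental_iff_injective.1 hα) r
  have hX : (RatFunc.X : RatFunc K) ∈
      IntermediateField.adjoin K {ratCoord p₁ q₁, ratCoord p₂ q₂} := hproper ▸ trivial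
  have key : σ RatFunc.X = algebraMap (RatFunc K) E RatFunc.X := by
    generalize (RatFunc.X : RatFunc K) = x at hX
    induction hX using IntermediateField.adjoin_induction with
    | mem x hx =>
      rcases hx with rfl | rfl
      · rw [hφ₁, ratCoord, map_div₀, hσ, hσ]
      · rw [hφ₂, ratCoord, map_div₀, hσ, hσ]
    | algebraMap x => rw [σ.commutes, ← IsScalarTower.algebraMap_apply]
    | add x y _ _ hx hy => rw [map_add, map_add, hx, hy]
    | inv x _ hx => rw [map_inv₀, map_inv₀, hx]
    | mul x y _ _ hx hy => rw [map_mul, map_mul, hx, hy]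
  rw [← key, ← RatFunc.algebraMap_X, hσ, aeval_X]

theorem exists_isCoprime_fibrePoly_factors [CharZero K] {p₁ q₁ p₂ q₂ : K[X]} (hq₁ : q₁ ≠ 0)
    (hq₂ : q₂ ≠ 0) (hpq₁ : IsCoprime p₁ q₁) (hpq₂ : IsCoprime p₂ q₂)
    (hdeg : 1 ≤ max p₁.natDegree q₁.natDegree)
    (hproper : IntermediateField.adjoin K {ratCoord p₁ q₁, ratCoord p₂ q₂} = ⊤) :
    ∃ F G : (RatFunc K)[X], fibrePoly p₁ q₁ = (X - C RatFunc.X) * F ∧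
      fibrePoly p₂ q₂ = (X - C RatFunc.X) * G ∧ IsCoprime F G := by
  obtain ⟨F, hF⟩ := dvd_iff_isRoot.2 (eval_X_fibrePoly (p := p₁) hq₁)
  obtain ⟨G, hG⟩ := dvd_iff_isRoot.2 (eval_X_fibrePoly (p := p₂) hq₂)
  refine ⟨F, G, hF, hG, ?_⟩
  rw [isCoprime_iff_aeval_ne_zero_of_isAlgClosed (RatFunc K) (AlgebraicClosure (RatFunc K))]
  intro α
  by_contra! hα
  have hαX := eq_X_of_aeval_fibrePoly_eq_zero hpq₁ hpq₂
    (transcendental_ratCoord hq₁ hpq₁ hdeg) hproper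
    (α := α) (by rw [hF, map_mul, hα.1, mul_zero]) (by rw [hG, map_mul, hα.2, mul_zero])
  apply eval_X_derivative_fibrePoly_ne_zero hq₁ hpq₁ hdeg
  have h0 : F.eval RatFunc.X = 0 := by
    have := hα.1
    rw [hαX, aeval_algebraMap_apply] at this
    simpa using this
  simp [hF, derivative_mul, h0]

/-- A syzygy `A (p₁ - φ₁ q₁) + B (p₂ - φ₂ q₂) = 0` of low degree with `B(0) = 0` is trivial. -/
theorem fibrePoly_syzygy_eq_zero [CharZero K] {p₁ q₁ p₂ q₂ : K[X]} (hq₁ : q₁ ≠ 0)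
    (hq₂ : q₂ ≠ 0) (hpq₁ : IsCoprime p₁ q₁) (hpq₂ : IsCoprime p₂ q₂)
    (hdeg : 1 ≤ max p₁.natDegree q₁.natDegree)
    (hproper : IntermediateField.adjoin K {ratCoord p₁ q₁, ratCoord p₂ q₂} = ⊤)
    {A B : (RatFunc K)[X]} (hAB : A * fibrePoly p₁ q₁ + B * fibrePoly p₂ q₂ = 0)
    (hB : B.natDegree < max p₁.natDegree q₁.natDegree) (hB0 : B.coeff 0 = 0) :
    A = 0 ∧ B = 0 := by
  have htr := transcendental_ratCoord hq₁ hpq₁ hdeg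
  obtain ⟨F, G, hF, hG, hFG⟩ := exists_isCoprime_fibrePoly_factors hq₁ hq₂ hpq₁ hpq₂ hdeg hproper
  have hc0 := coeff_zero_fibrePoly_ne_zero hpq₁ htr
  have hF0 : F.coeff 0 ≠ 0 := by
    rw [hF, mul_coeff_zero] at hc0
    exact right_ne_zero_of_mul hc0
  have hFne : F ≠ 0 := fun h => hF0 (by simp [h])
  have hXC : (X - C RatFunc.X : (RatFunc K)[X]) ≠ 0 := X_sub_C_ne_zero _
  have hFdeg : F.natDegree + 1 = max p₁.natDegree q₁.natDegree := by
    rw [← natDegree_fibrePoly htr, hF, natDegree_mul hXC hFne, natDegree_X_sub_C, add_comm]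
  have hAB' : A * F + B * G = 0 := by
    apply (mul_eq_zero.1 (_ : (X - C RatFunc.X) * (A * F + B * G) = 0)).resolve_left hXC
    rw [← hAB, hF, hG]
    ring
  obtain ⟨D, hD⟩ : F ∣ B := by
    refine hFG.dvd_of_dvd_mul_right ⟨-A, ?_⟩
    linear_combination hAB'
  have hBzero : B = 0 := by
    by_contra hne
    have hDne : D ≠ 0 := fun h => hne (by rw [hD, h, mul_zero])
    have hD0 : D.natDegree = 0 := by
      rw [hD, natDegree_mul hFne hDne] at hB
      omega
    rw [hD, mul_coeff_zero] at hB0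
    rw [eq_C_of_natDegree_eq_zero hD0, (mul_eq_zero.1 hB0).resolve_left hF0, C_0] at hDne
    exact hDne rfl
  refine ⟨?_, hBzero⟩
  rw [hBzero, zero_mul, add_zero] at hAB'
  exact (mul_eq_zero.1 hAB').resolve_right hFne

end fibrePoly

open Matrix in
/-- If the first `N` columns of `S` are independent and `v` annihilates them, then their signed
maximal minors form a nonzero multiple of `v`. -/
theorem exists_signed_minors_eq_mul {L : Type*} [Field L] {N : ℕ}
    (S : Matrix (Fin (N + 1)) (Fin (N + 1)) L) (v : Fin (N + 1) → L)
    (hv : ∀ j : Fin N, (v ᵥ* S) j.castSucc = 0) (hlast : v (Fin.last N) = 1)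
    (hinj : ∀ c, c (Fin.last N) = 0 → S *ᵥ c = 0 → c = 0) :
    ∃ d ≠ 0, ∀ i : Fin (N + 1), (-1) ^ (i : ℕ) *
      (Matrix.of fun (r : Fin N) (j : Fin N) => S (i.succAbove r) j.castSucc).det = d * v i := by
  set W := S.updateCol (Fin.last N) (Pi.single (Fin.last N) 1) with hW
  have hvW : v ᵥ* W = Pi.single (Fin.last N) 1 := by
    ext j
    induction j using Fin.lastCases with
    | last => simp [hW, vecMul, dotProduct, Pi.single_apply, hlast]
    | cast j =>
      rw [Pi.single_eq_of_ne (Fin.castSucc_lt_last j).ne, ← hv j]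
      simp [hW, vecMul, dotProduct, (Fin.castSucc_lt_last j).ne]
  have hdet : W.det ≠ 0 := by
    intro h0
    obtain ⟨c, hc, hWc⟩ := exists_mulVec_eq_zero_iff.2 h0
    have hcl : c (Fin.last N) = 0 := by
      have := dotProduct_mulVec v W c
      rw [hWc, hvW] at this
      simpa using this.symm
    refine hc (hinj c hcl ?_)
    rw [← hWc]
    ext i
    simp only [mulVec, dotProduct]
    refine Finset.sum_congr rfl fun j _ => ?_
    by_cases hj : j = Fin.last N
    · simp [hj, hcl]
    · simp [hW, hj]
  refine ⟨(-1) ^ N * W.det, by simpa using hdet, fun i => ?_⟩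
  have hadj : (v ᵥ* W) ᵥ* W.adjugate = W.det • v := by
    rw [vecMul_vecMul, mul_adjugate, vecMul_smul, vecMul_one]
  have hi := congrFun hadj i
  rw [hvW, single_one_vecMul, row_apply, adjugate_fin_succ_eq_det_submatrix] at hi
  have hsub : W.submatrix i.succAbove (Fin.last N).succAbove =
      Matrix.of fun (r : Fin N) (j : Fin N) => S (i.succAbove r) j.castSucc := by
    ext r j
    simp [hW, (Fin.castSucc_lt_last j).ne]
  rw [hsub, Pi.smul_apply, smul_eq_mul, Fin.val_last, pow_add] at hi
  have hsq : ((-1 : L) ^ N) * (-1) ^ N = 1 := by rw [← mul_pow]; simp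
  linear_combination (-1) ^ N * hi - (-1) ^ (i : ℕ) *
    (Matrix.of fun (r : Fin N) (j : Fin N) => S (i.succAbove r) j.castSucc).det * hsq

/-- inversion formulas for proper plane curve parameterizations.
With the Sylvester-matrix setup for the plane curve parameterization `t ↦ (p₁/q₁, p₂/q₂)`,
if the parameterization is proper, i.e. `K(φ₁,φ₂) = K(t)`, then for every
`1 ≤ i ≤ m+n-1` one has `Δ_{i+1}(φ₁,φ₂) ≠ 0` and `Δᵢ(φ₁,φ₂) = t·Δ_{i+1}(φ₁,φ₂)` in
`K(t)`; in other words `(x,y) ↦ Δᵢ/Δ_{i+1}` is an inversion of the parameterization. -/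
theorem curve_inversion_formulas_of_proper
    (K : Type*) [Field K] [CharZero K]
    (p₁ q₁ p₂ q₂ : Polynomial K)
    (hq₁ : q₁ ≠ 0) (hq₂ : q₂ ≠ 0)
    (hcop₁ : IsCoprime p₁ q₁) (hcop₂ : IsCoprime p₂ q₂)
    (m n : ℕ)
    (hm : m = max p₁.natDegree q₁.natDegree) (hm1 : 1 ≤ m)
    (hn : n = max p₂.natDegree q₂.natDegree) (hn1 : 1 ≤ n)
    (N : ℕ) (hN : m + n = N + 1)
    (f g : Polynomial (MvPolynomial (Fin 2) K))
    (hf : f = p₁.map (algebraMap K (MvPolynomial (Fin 2) K)) -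
      Polynomial.C (MvPolynomial.X 0) * q₁.map (algebraMap K (MvPolynomial (Fin 2) K)))
    (hg : g = p₂.map (algebraMap K (MvPolynomial (Fin 2) K)) -
      Polynomial.C (MvPolynomial.X 1) * q₂.map (algebraMap K (MvPolynomial (Fin 2) K)))
    (S : Matrix (Fin (N + 1)) (Fin (N + 1)) (MvPolynomial (Fin 2) K))
    (hS : ∀ i : Fin (N + 1),
      (∑ c : Fin (N + 1), Polynomial.C (S c i) *
          (Polynomial.X : Polynomial (MvPolynomial (Fin 2) K)) ^ (N - (c : ℕ))) =
        if (i : ℕ) < n then Polynomial.X ^ (n - 1 - (i : ℕ)) * f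
        else Polynomial.X ^ (m + n - 1 - (i : ℕ)) * g)
    (Δ : Fin (N + 1) → MvPolynomial (Fin 2) K)
    (hΔ : ∀ i : Fin (N + 1),
      Δ i = (-1 : MvPolynomial (Fin 2) K) ^ (i : ℕ) *
        (Matrix.of fun (r : Fin N) (j : Fin N) => S (i.succAbove r) j.castSucc).det)
    (hproper : IntermediateField.adjoin K {ratCoord p₁ q₁, ratCoord p₂ q₂} = ⊤) :
    ∀ i : Fin N,
      MvPolynomial.aeval ![ratCoord p₁ q₁, ratCoord p₂ q₂] (Δ i.succ) ≠ 0 ∧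
      MvPolynomial.aeval ![ratCoord p₁ q₁, ratCoord p₂ q₂] (Δ i.castSucc) =
        RatFunc.X * MvPolynomial.aeval ![ratCoord p₁ q₁, ratCoord p₂ q₂] (Δ i.succ) := by
  set φ := MvPolynomial.aeval (R := K) ![ratCoord p₁ q₁, ratCoord p₂ q₂] with hφ
  have hmap (r : Polynomial K) : (r.map (algebraMap K (MvPolynomial (Fin 2) K))).map
      (φ : MvPolynomial (Fin 2) K →+* RatFunc K) = r.map (algebraMap K (RatFunc K)) := by
    rw [Polynomial.map_map, AlgHom.comp_algebraMap]
  have hfφ : f.map (φ : MvPolynomial (Fin 2) K →+* RatFunc K) = fibrePoly p₁ q₁ := by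
    rw [hf, Polynomial.map_sub, Polynomial.map_mul, hmap, hmap, Polynomial.map_C, fibrePoly]
    simp [hφ]
  have hgφ : g.map (φ : MvPolynomial (Fin 2) K →+* RatFunc K) = fibrePoly p₂ q₂ := by
    rw [hg, Polynomial.map_sub, Polynomial.map_mul, hmap, hmap, Polynomial.map_C, fibrePoly]
    simp [hφ]
  have hSφ (i : Fin (N + 1)) :
      ∑ c : Fin (N + 1), Polynomial.C (φ (S c i)) * Polynomial.X ^ (N - (c : ℕ)) =
        if (i : ℕ) < n then Polynomial.X ^ (n - 1 - (i : ℕ)) * fibrePoly p₁ q₁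
        else Polynomial.X ^ (m + n - 1 - (i : ℕ)) * fibrePoly p₂ q₂ := by
    have := congrArg (Polynomial.map (φ : MvPolynomial (Fin 2) K →+* RatFunc K)) (hS i)
    rw [← hfφ, ← hgφ]
    rw [Polynomial.map_sum, apply_ite (Polynomial.map _)] at this
    simpa using this
  have hker (j : Fin N) : Matrix.vecMul (fun c : Fin (N + 1) => RatFunc.X ^ (N - (c : ℕ)))
      (S.map φ) j.castSucc = 0 := by
    have := congrArg (Polynomial.eval RatFunc.X) (hSφ j.castSucc)
    rw [apply_ite (Polynomial.eval _), Polynomial.eval_mul, Polynomial.eval_mul,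
      eval_X_fibrePoly hq₁, eval_X_fibrePoly hq₂, mul_zero, mul_zero, ite_self,
      Polynomial.eval_finsetSum] at this
    rw [← this]
    simp only [Matrix.vecMul, dotProduct]
    refine Finset.sum_congr rfl fun c _ => ?_
    rw [Polynomial.eval_mul, Polynomial.eval_C, Polynomial.eval_pow, Polynomial.eval_X, mul_comm,
      Matrix.map_apply]
  have hinj (c : Fin (N + 1) → RatFunc K) (hcl : c (Fin.last N) = 0)
      (hc : Matrix.mulVec (S.map φ) c = 0) : c = 0 := by
    let A : Polynomial (RatFunc K) := ∑ j : Fin (N + 1),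
      if (j : ℕ) < n then Polynomial.C (c j) * Polynomial.X ^ (n - 1 - (j : ℕ)) else 0
    let B : Polynomial (RatFunc K) := ∑ j : Fin (N + 1),
      if (j : ℕ) < n then 0 else Polynomial.C (c j) * Polynomial.X ^ (m + n - 1 - (j : ℕ))
    have hAcoeff (j : Fin (N + 1)) (hj : (j : ℕ) < n) : A.coeff (n - 1 - j) = c j := by
      rw [Polynomial.finsetSum_coeff, Finset.sum_eq_single j]
      · simp [hj]
      · intro k _ hkj
        have hkj' : (k : ℕ) ≠ j := Fin.val_ne_of_ne hkj
        split_ifs with hk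
        · rw [Polynomial.coeff_C_mul_X_pow, if_neg (by omega)]
        · simp
      · simp
    have hBcoeff (j : Fin (N + 1)) (hj : ¬ (j : ℕ) < n) : B.coeff (m + n - 1 - j) = c j := by
      rw [Polynomial.finsetSum_coeff, Finset.sum_eq_single j]
      · simp [hj]
      · intro k _ hkj
        have hkj' : (k : ℕ) ≠ j := Fin.val_ne_of_ne hkj
        split_ifs with hk
        · simp
        · rw [Polynomial.coeff_C_mul_X_pow, if_neg (by omega)]
      · simp
    have hB0 : B.coeff 0 = 0 := by
      rw [← hcl, ← hBcoeff (Fin.last N) (by rw [Fin.val_last]; omega), Fin.val_last,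
        show m + n - 1 - N = 0 by omega]
    have hBdeg : B.natDegree < m := by
      refine lt_of_le_of_lt (Polynomial.natDegree_sum_le_of_forall_le (n := m - 1) _ _ ?_)
        (by omega)
      intro j _
      split_ifs with hj
      · simp
      · exact (Polynomial.natDegree_C_mul_X_pow_le _ _).trans (by omega)
    have hAB : A * fibrePoly p₁ q₁ + B * fibrePoly p₂ q₂ = 0 := by
      have hcol : A * fibrePoly p₁ q₁ + B * fibrePoly p₂ q₂ = ∑ j : Fin (N + 1),
          Polynomial.C (c j) *
            ∑ k : Fin (N + 1), Polynomial.C (φ (S k j)) * Polynomial.X ^ (N - (k : ℕ)) := by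
        rw [Finset.sum_mul, Finset.sum_mul, ← Finset.sum_add_distrib]
        refine Finset.sum_congr rfl fun j _ => ?_
        rw [hSφ]
        split_ifs <;> ring
      simp_rw [Finset.mul_sum] at hcol
      rw [hcol, Finset.sum_comm]
      refine Finset.sum_eq_zero fun k _ => ?_
      have hk : ∑ j, φ (S k j) * c j = 0 := congrFun hc k
      simp_rw [← mul_assoc, ← Finset.sum_mul, ← Polynomial.C_mul, mul_comm (c _)]
      rw [← map_sum, hk, Polynomial.C_0, zero_mul]
    obtain ⟨hA, hB⟩ := fibrePoly_syzygy_eq_zero hq₁ hq₂ hcop₁ hcop₂ (hm ▸ hm1) hproper hAB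
      (hm ▸ hBdeg) hB0
    ext j
    by_cases hj : (j : ℕ) < n
    · rw [← hAcoeff j hj, hA, Polynomial.coeff_zero, Pi.zero_apply]
    · rw [← hBcoeff j hj, hB, Polynomial.coeff_zero, Pi.zero_apply]
  obtain ⟨d, hd, hdv⟩ := exists_signed_minors_eq_mul (S.map φ)
    (fun c : Fin (N + 1) => RatFunc.X ^ (N - (c : ℕ))) hker (by simp) hinj
  have hΔv (i : Fin (N + 1)) : φ (Δ i) = d * RatFunc.X ^ (N - (i : ℕ)) := by
    rw [← hdv i, hΔ i, map_mul, map_pow, map_neg, map_one, AlgHom.map_det]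
    rfl
  intro i
  rw [hΔv, hΔv, Fin.val_succ, Fin.val_castSucc]
  refine ⟨mul_ne_zero hd (pow_ne_zero _ RatFunc.X_ne_zero), ?_⟩
  rw [show N - (i : ℕ) = N - (i + 1) + 1 by omega, pow_succ]
  ring
end

section
/- Theorem (resultant of a plane curve parameterization is a power of the implicit equation). Assume C ∈ K[x,y] is an implicit equation of the parameterized curve, i.e. C is irreducible and, for every G ∈ K[x,y], G(φ₁,φ₂) = 0 in K(t) if and only if C divides G. The field extension K(φ₁,φ₂) ⊆ K(t) is finite; let e := [K(t) : K(φ₁,φ₂)] be its degree (the degree of the parameterization). Then the resultant with respect to t of f = p₁ − x·q₁ and g = p₂ − y·q₂ (taken with the degrees m and n in t), which equals det S ∈ K[x,y], is associated to C^e, i.e. Res_{m,n}(p₁ − x·q₁, p₂ − y·q₂) = C(x,y)^e up to multiplication by a nonzero constant of K. -/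
open Polynomial

namespace CurveResultant

section Specialization

variable {K B : Type*} [CommRing K] [CommRing B] [Algebra K B]

/-- The specialization `K[x₀, x₁] → B[Y]` sending `x_j` to `Y` and the other variable to `b`. -/
noncomputable def specialize (b : B) (j : Fin 2) : MvPolynomial (Fin 2) K →ₐ[K] B[X] :=
  MvPolynomial.aeval fun l ↦ if l = j then X else C b

@[simp]
lemma specialize_X_self (b : B) (j : Fin 2) :
    specialize (K := K) b j (MvPolynomial.X j) = X := by simp [specialize]

lemma specialize_X_of_ne (b : B) {i j : Fin 2} (hij : i ≠ j) :
    specialize (K := K) b j (MvPolynomial.X i) = C b := by simp [specialize, hij]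

lemma eq_of_ne_of_ne {i j l : Fin 2} (hij : i ≠ j) (hl : l ≠ j) : l = i := by lia

lemma map_specialize {B' : Type*} [CommRing B'] [Algebra K B'] (ψ : B →ₐ[K] B') (b : B)
    (j : Fin 2) (G : MvPolynomial (Fin 2) K) :
    (specialize b j G).map (ψ : B →+* B') = specialize (ψ b) j G := by
  have : (mapAlgHom ψ).comp (specialize b j) = specialize (ψ b) j := by
    ext l : 1
    by_cases hl : l = j <;> simp [specialize, hl]
  exact DFunLike.congr_fun this G

lemma specialize_eq_map (b : B) (j : Fin 2) (G : MvPolynomial (Fin 2) K) :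
    specialize b j G =
      (specialize (X : K[X]) j G).map ((aeval b : K[X] →ₐ[K] B) : K[X] →+* B) := by
  rw [map_specialize, aeval_X]

lemma eval₂_specialize_X {i j : Fin 2} (hij : i ≠ j) (G : MvPolynomial (Fin 2) K) :
    (specialize (X : K[X]) j G).eval₂
      (aeval (MvPolynomial.X i : MvPolynomial (Fin 2) K)).toRingHom (MvPolynomial.X j) = G := by
  have : (eval₂AlgHom (aeval (MvPolynomial.X i : MvPolynomial (Fin 2) K))
      (MvPolynomial.X j) fun _ ↦ Commute.all _ _).comp (specialize (X : K[X]) j) = AlgHom.id K _ := by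
    ext l : 1
    by_cases hl : l = j
    · simp [specialize, hl]
    · obtain rfl := eq_of_ne_of_ne hij hl
      simp [specialize, hl]
  exact DFunLike.congr_fun this G

lemma specialize_X_injective (j : Fin 2) :
    Function.Injective (specialize (K := K) (X : K[X]) j) := by
  obtain ⟨i, hij⟩ := exists_ne j
  exact Function.LeftInverse.injective (eval₂_specialize_X hij)

lemma exists_specialize_X_eq {i j : Fin 2} (hij : i ≠ j) (P : K[X][X]) :
    ∃ G : MvPolynomial (Fin 2) K, specialize (X : K[X]) j G = P := by
  induction P using Polynomial.induction_on' with
  | add P Q hP hQ =>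
    obtain ⟨⟨G, rfl⟩, ⟨H, rfl⟩⟩ := And.intro hP hQ
    exact ⟨G + H, map_add _ _ _⟩
  | monomial n a =>
    refine ⟨aeval (MvPolynomial.X i) a * MvPolynomial.X j ^ n, ?_⟩
    rw [map_mul, map_pow, specialize_X_self, ← aeval_algHom_apply, specialize_X_of_ne _ hij,
      ← C_mul_X_pow_eq_monomial]
    congr 1
    change aeval ((CAlgHom : K[X] →ₐ[K] K[X][X]) X) a = _
    rw [aeval_algHom_apply]
    simp

lemma natDegree_specialize {b : B} (hb : Transcendental K b) (j : Fin 2)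
    (G : MvPolynomial (Fin 2) K) :
    (specialize b j G).natDegree = (specialize (X : K[X]) j G).natDegree := by
  rw [specialize_eq_map]
  exact natDegree_map_eq_of_injective (transcendental_iff_injective.mp hb) _

lemma specialize_injective {b : B} (hb : Transcendental K b) (j : Fin 2) :
    Function.Injective (specialize (K := K) b j) := by
  intro G H h
  rw [specialize_eq_map, specialize_eq_map b j H] at h
  exact specialize_X_injective j
    (map_injective _ (transcendental_iff_injective.mp hb) h)

lemma eval_specialize (a : Fin 2 → B) {i j : Fin 2} (hij : i ≠ j)
    (G : MvPolynomial (Fin 2) K) :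
    (specialize (a i) j G).eval (a j) = MvPolynomial.aeval a G := by
  have : ((aeval (a j) : B[X] →ₐ[B] B).restrictScalars K).comp (specialize (a i) j) =
      MvPolynomial.aeval a := by
    ext l : 1
    by_cases hl : l = j
    · simp [specialize, hl]
    · obtain rfl := eq_of_ne_of_ne hij hl
      simp [specialize, hl]
  simpa [aeval_def, eval₂_eq_eval_map] using DFunLike.congr_fun this G

/-- A bivariate polynomial that has degree zero in each variable is constant. -/
lemma exists_eq_C_of_natDegree_specialize_eq_zero {G : MvPolynomial (Fin 2) K}
    (h : ∀ j, (specialize (X : K[X]) j G).natDegree = 0) : ∃ u, G = MvPolynomial.C u := by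
  have key (i j : Fin 2) (hij : i ≠ j) : ∃ a : K[X], G = aeval (MvPolynomial.X i) a := by
    refine ⟨(specialize (X : K[X]) j G).coeff 0, ?_⟩
    conv_lhs => rw [← eval₂_specialize_X hij G, eq_C_of_natDegree_eq_zero (h j), eval₂_C]
    rfl
  obtain ⟨a, ha⟩ := key 0 1 (by decide)
  obtain ⟨b, hb⟩ := key 1 0 (by decide)
  let σ : MvPolynomial (Fin 2) K →ₐ[K] MvPolynomial (Fin 2) K :=
    MvPolynomial.aeval ![MvPolynomial.X 0, 0]
  have h₁ : σ G = G := by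
    nth_rw 1 [ha]
    rw [← aeval_algHom_apply, ha]
    simp [σ]
  refine ⟨b.coeff 0, ?_⟩
  rw [← h₁, hb, ← aeval_algHom_apply]
  simp [σ, coeff_zero_eq_aeval_zero', ← MvPolynomial.algebraMap_eq]

end Specialization

section Fiber

/-- The polynomial `p - b * q`, whose roots are the parameters mapped to `b` by `p / q`. -/
noncomputable def fiber {K B : Type*} [CommRing K] [CommRing B] [Algebra K B] (b : B)
    (p q : K[X]) : B[X] :=
  p.map (algebraMap K B) - C b * q.map (algebraMap K B)

lemma map_fiber {K B B' : Type*} [CommRing K] [CommRing B] [CommRing B'] [Algebra K B]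
    [Algebra K B'] (ψ : B →ₐ[K] B') (b : B) (p q : K[X]) :
    (fiber b p q).map (ψ : B →+* B') = fiber (ψ b) p q := by
  simp [fiber, Polynomial.map_map]

lemma natDegree_fiber_le {K B : Type*} [CommRing K] [CommRing B] [Algebra K B] (b : B)
    (p q : K[X]) : (fiber b p q).natDegree ≤ max p.natDegree q.natDegree :=
  (natDegree_sub_le _ _).trans
    (max_le_max natDegree_map_le ((natDegree_C_mul_le _ _).trans natDegree_map_le))

lemma eval_fiber {K B : Type*} [CommRing K] [CommRing B] [Algebra K B] (b α : B)
    (p q : K[X]) : (fiber b p q).eval α = aeval α p - b * aeval α q := by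
  simp [fiber]

variable {K L : Type*} [Field K] [Field L] [Algebra K L] {p q p' q' : K[X]} {φ : L}

lemma natDegree_fiber (hq : q ≠ 0) (hφ : Transcendental K φ) :
    (fiber φ p q).natDegree = max p.natDegree q.natDegree := by
  refine (natDegree_fiber_le _ _ _).antisymm (le_natDegree_of_ne_zero fun h ↦ ?_)
  set m := max p.natDegree q.natDegree with hm
  simp only [fiber, coeff_sub, coeff_map, coeff_C_mul] at h
  by_cases hqm : q.coeff m = 0
  · have hlt : q.natDegree < m := lt_of_le_of_ne (le_max_right _ _) fun h' ↦ by
      rw [← h', coeff_natDegree, leadingCoeff_eq_zero] at hqm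
      exact hq hqm
    have hpm : p.natDegree = m := by lia
    rw [hqm, map_zero, mul_zero, sub_zero, map_eq_zero, ← hpm, coeff_natDegree,
      leadingCoeff_eq_zero] at h
    simp [h] at hpm
    lia
  · refine hφ ?_
    have : φ = algebraMap K L (p.coeff m / q.coeff m) := by
      rw [map_div₀, eq_div_iff (by simpa using hqm)]
      exact (sub_eq_zero.mp h).symm
    rw [this]
    exact isAlgebraic_algebraMap _

lemma aeval_ne_zero_of_isCoprime (hcop : IsCoprime p q) {α : L}
    (hα : aeval α p = φ * aeval α q) : aeval α q ≠ 0 := by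
  intro h
  obtain ⟨a, b, hab⟩ := hcop
  simpa [h, hα] using congrArg (aeval α) hab

lemma transcendental_of_aeval_eq (hcop : IsCoprime p q) (hφ : Transcendental K φ) {α : L}
    (hα : aeval α p = φ * aeval α q) : Transcendental K α := by
  intro halg
  refine hφ ?_
  rw [eq_div_of_mul_eq (aeval_ne_zero_of_isCoprime hcop hα) hα.symm, div_eq_mul_inv]
  have h (r : K[X]) : IsAlgebraic K (aeval α r) :=
    isAlgebraic_iff_isIntegral.mpr <|
      adjoin_le_integralClosure halg.isIntegral (aeval_mem_adjoin_singleton K α)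
  exact (h p).mul (h q).inv

variable [IsAlgClosed L]

lemma specialize_resultant (hq : q ≠ 0) (hφ : Transcendental K φ) {i j : Fin 2} (hij : i ≠ j) :
    specialize φ j (resultant (fiber (MvPolynomial.X i : MvPolynomial (Fin 2) K) p q)
      (fiber (MvPolynomial.X j) p' q') (max p.natDegree q.natDegree)
      (max p'.natDegree q'.natDegree)) =
    C ((fiber φ p q).leadingCoeff ^ max p'.natDegree q'.natDegree) *
      ((fiber φ p q).roots.map fun α ↦
        C (aeval α p') - X * C (aeval α q')).prod := by
  change (specialize (K := K) φ j : MvPolynomial (Fin 2) K →+* L[X]) _ = _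
  rw [← resultant_map_map, map_fiber, map_fiber, specialize_X_self, specialize_X_of_ne _ hij,
    show (C φ : L[X]) = (CAlgHom : L →ₐ[K] L[X]) φ from rfl, ← map_fiber,
    ← natDegree_fiber (p := p) hq hφ]
  have hinj : Function.Injective ((CAlgHom : L →ₐ[K] L[X]) : L →+* L[X]) := C_injective
  have hs := IsAlgClosed.splits (fiber φ p q)
  rw [← natDegree_map_eq_of_injective hinj,
    resultant_eq_prod_eval _ _ _ (natDegree_fiber_le _ _ _) (hs.map _),
    leadingCoeff_map_of_injective hinj, hs.roots_map_of_injective hinj, Multiset.map_map]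
  congr 1
  · simp
  · congr 1
    refine Multiset.map_congr rfl fun α _ ↦ ?_
    simp only [Function.comp_apply, eval_fiber, RingHom.coe_coe, aeval_algHom_apply]
    simp

end Fiber

section Curve

variable {K : Type*} [Field K] {p q : Fin 2 → K[X]}

/-- The resultant of `p i - x_i * q i` and `p j - x_j * q j`, formed with respect to their
degrees as polynomials over `K[x₀, x₁]`. -/
noncomputable def curveResultant (p q : Fin 2 → K[X]) (i j : Fin 2) : MvPolynomial (Fin 2) K :=
  resultant (fiber (MvPolynomial.X i) (p i) (q i)) (fiber (MvPolynomial.X j) (p j) (q j))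
    (max (p i).natDegree (q i).natDegree) (max (p j).natDegree (q j).natDegree)

lemma transcendental_ratCoord {p q : K[X]} (hq : q ≠ 0) (hcop : IsCoprime p q)
    (hdeg : 1 ≤ max p.natDegree q.natDegree) : Transcendental K (ratCoord p q) := by
  refine RatFunc.transcendental_of_ne_C _ fun ⟨c, hc⟩ ↦ ?_
  rw [ratCoord, div_eq_iff (RatFunc.algebraMap_ne_zero hq), ← RatFunc.algebraMap_C,
    ← map_mul] at hc
  obtain rfl := RatFunc.algebraMap_injective K hc
  have hu : IsUnit q := hcop.isUnit_of_dvd' (dvd_mul_left _ _) dvd_rfl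
  have := natDegree_C_mul_le c q
  have := natDegree_eq_zero_of_isUnit hu
  lia

lemma finrank_adjoin_ratCoord {p q : K[X]} (hq : q ≠ 0) (hcop : IsCoprime p q) :
    Module.finrank (IntermediateField.adjoin K {ratCoord p q}) (RatFunc K) =
      max p.natDegree q.natDegree := by
  rw [RatFunc.finrank_eq_max_natDegree]
  have h : (ratCoord p q).num * q = p * (ratCoord p q).denom :=
    (RatFunc.num_mul_eq_mul_denom_iff hq).mpr rfl
  have hcop' := RatFunc.isCoprime_num_denom (ratCoord p q)
  have hp : Associated (ratCoord p q).num p :=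
    associated_of_dvd_dvd (hcop'.dvd_of_dvd_mul_right (Dvd.intro _ h))
      (hcop.dvd_of_dvd_mul_right (Dvd.intro _ h.symm))
  have hq : Associated (ratCoord p q).denom q :=
    associated_of_dvd_dvd (hcop'.symm.dvd_of_dvd_mul_left (Dvd.intro_left _ h.symm))
      (hcop.symm.dvd_of_dvd_mul_left (Dvd.intro_left _ h))
  rw [natDegree_eq_of_degree_eq (degree_eq_degree_of_associated hp),
    natDegree_eq_of_degree_eq (degree_eq_degree_of_associated hq)]

lemma aeval_ratCoord_eq_zero_iff {L : Type*} [Field L] [Algebra K L] {α : L}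
    (hα : Transcendental K α) (hcop : ∀ l, IsCoprime (p l) (q l)) {a : Fin 2 → L}
    (ha : ∀ l, aeval α (p l) = a l * aeval α (q l)) (G : MvPolynomial (Fin 2) K) :
    MvPolynomial.aeval (fun l ↦ ratCoord (p l) (q l)) G = 0 ↔ MvPolynomial.aeval a G = 0 := by
  let ψ : RatFunc K →ₐ[K] L := RatFunc.liftAlgHom (aeval α)
    (nonZeroDivisors_le_comap_nonZeroDivisors_of_injective _ (transcendental_iff_injective.mp hα))
  have hψ : (fun l ↦ ψ (ratCoord (p l) (q l))) = a := by
    funext l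
    rw [ratCoord, RatFunc.liftAlgHom_apply_div, ha,
      mul_div_cancel_right₀ _ (aeval_ne_zero_of_isCoprime (hcop l) (ha l))]
  rw [← hψ, ← MvPolynomial.comp_aeval_apply, map_eq_zero_iff ψ ψ.injective]

variable {L : Type*} [Field L] [Algebra K L] {φ : L} {i j : Fin 2}

lemma fiber_ne_zero (hq : q i ≠ 0) (hdeg : 1 ≤ max (p i).natDegree (q i).natDegree)
    (hφ : Transcendental K φ) : fiber φ (p i) (q i) ≠ 0 :=
  ne_zero_of_natDegree_gt (n := 0) (by rwa [natDegree_fiber hq hφ])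

variable [IsAlgClosed L]

lemma exists_parameter_of_eval_specialize_eq_zero (hq : q i ≠ 0)
    (hdeg : 1 ≤ max (p i).natDegree (q i).natDegree)
    (hcop : IsCoprime (p i) (q i)) (hφ : Transcendental K φ) (hij : i ≠ j) {β : L}
    (hβ : (specialize φ j (curveResultant p q i j)).eval β = 0) :
    ∃ α : L, Transcendental K α ∧ aeval α (p i) = φ * aeval α (q i) ∧
      aeval α (p j) = β * aeval α (q j) := by
  have h₀ := fiber_ne_zero hq hdeg hφ
  rw [curveResultant, specialize_resultant hq hφ hij, eval_mul, eval_C, mul_eq_zero,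
    or_iff_right (pow_ne_zero _ (leadingCoeff_ne_zero.mpr h₀)),
    eval_multiset_prod, Multiset.prod_eq_zero_iff] at hβ
  simp only [Multiset.mem_map, exists_exists_and_eq_and, mem_roots h₀, IsRoot, eval_fiber,
    eval_sub, eval_mul, eval_X, eval_C, sub_eq_zero] at hβ
  obtain ⟨α, hα, hβ⟩ := hβ
  exact ⟨α, transcendental_of_aeval_eq hcop hφ hα, hα, hβ⟩

lemma specialize_curveResultant_ne_zero_and_natDegree (hq : ∀ l, q l ≠ 0)
    (hdeg : 1 ≤ max (p i).natDegree (q i).natDegree)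
    (hcop : IsCoprime (p i) (q i)) (hφ : Transcendental K φ) (hij : i ≠ j) :
    specialize φ j (curveResultant p q i j) ≠ 0 ∧
    (specialize φ j (curveResultant p q i j)).natDegree =
      max (p i).natDegree (q i).natDegree := by
  have h₀ := fiber_ne_zero (hq i) hdeg hφ
  have hlin {α : L} (hα : α ∈ (fiber φ (p i) (q i)).roots) :
      (C (aeval α (p j)) - X * C (aeval α (q j)) : L[X]).natDegree = 1 := by
    rw [mem_roots h₀, IsRoot, eval_fiber, sub_eq_zero] at hα
    have hα' : aeval α (q j) ≠ 0 := fun h ↦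
      transcendental_of_aeval_eq hcop hφ hα ⟨q j, hq j, h⟩
    rw [mul_comm, natDegree_sub, natDegree_sub_C]
    exact natDegree_C_mul_X _ hα'
  have hne : (0 : L[X]) ∉ (fiber φ (p i) (q i)).roots.map fun α ↦
      C (aeval α (p j)) - X * C (aeval α (q j)) := fun h ↦ by
    obtain ⟨α, hα, h⟩ := Multiset.mem_map.mp h
    simpa only [h, natDegree_zero, zero_ne_one] using hlin hα
  have hc := pow_ne_zero (max (p j).natDegree (q j).natDegree) (leadingCoeff_ne_zero.mpr h₀)
  rw [curveResultant, specialize_resultant (hq i) hφ hij]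
  refine ⟨mul_ne_zero (C_ne_zero.mpr hc) (Multiset.prod_ne_zero hne), ?_⟩
  have hmap : (fiber φ (p i) (q i)).roots.map
      (natDegree ∘ fun α ↦ C (aeval α (p j)) - X * C (aeval α (q j))) =
        (fiber φ (p i) (q i)).roots.map fun _ ↦ 1 :=
    Multiset.map_congr rfl fun α hα ↦ hlin hα
  rw [natDegree_C_mul hc, natDegree_multiset_prod _ hne, Multiset.map_map, hmap,
    Multiset.map_const', Multiset.sum_replicate, ← natDegree_fiber (hq i) hφ,
    (IsAlgClosed.splits _).natDegree_eq_card_roots, smul_eq_mul, mul_one]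

/-- A factor of the resultant that does not vanish on the curve has degree zero in `x_j`. -/
lemma natDegree_specialize_eq_zero_of_dvd (hq : ∀ l, q l ≠ 0)
    (hdeg : ∀ l, 1 ≤ max (p l).natDegree (q l).natDegree)
    (hcop : ∀ l, IsCoprime (p l) (q l)) (hij : i ≠ j) {Q : MvPolynomial (Fin 2) K}
    (hQ : Q ∣ curveResultant p q i j)
    (hQ' : MvPolynomial.aeval (fun l ↦ ratCoord (p l) (q l)) Q ≠ 0) :
    (specialize (X : K[X]) j Q).natDegree = 0 := by
  let L := AlgebraicClosure (RatFunc K)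
  let φ : L := algebraMap (RatFunc K) L (ratCoord (p i) (q i))
  have hφ : Transcendental K φ :=
    (transcendental_algebraMap_iff (FaithfulSMul.algebraMap_injective _ _)).mpr
      (transcendental_ratCoord (hq i) (hcop i) (hdeg i))
  rw [← natDegree_specialize hφ]
  by_contra h
  obtain ⟨β, hβ⟩ := IsAlgClosed.exists_root (specialize φ j Q)
    fun h' ↦ h (natDegree_eq_zero_iff_degree_le_zero.mpr h'.le)
  obtain ⟨α, hα, hi, hj⟩ := exists_parameter_of_eval_specialize_eq_zero (hq i) (hdeg i) (hcop i)
    hφ hij (eval_eq_zero_of_dvd_of_eval_eq_zero (map_dvd (specialize φ j) hQ) hβ)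
  let a : Fin 2 → L := fun l ↦ if l = j then β else φ
  have hai : a i = φ := if_neg hij
  have haj : a j = β := if_pos rfl
  refine hQ' ((aeval_ratCoord_eq_zero_iff (a := a) hα hcop (fun l ↦ ?_) Q).mpr ?_)
  · by_cases hl : l = j
    · rw [hl, haj, hj]
    · rw [eq_of_ne_of_ne hij hl, hai, hi]
  · rw [← eval_specialize a hij, hai, haj]
    exact hβ

end Curve

section Degree

open IntermediateField

variable {K E : Type*} [Field K] [Field E] [Algebra K E]

lemma exists_map_aeval_eq_C_mul {b : E} (hb : Transcendental K b) (μ : K⟮b⟯[X]) :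
    ∃ (d : K[X]) (P : K[X][X]), d ≠ 0 ∧
      P.map ((aeval b : K[X] →ₐ[K] E) : K[X] →+* E) =
        C (aeval b d) * μ.map (algebraMap K⟮b⟯ E) := by
  induction μ using Polynomial.induction_on' with
  | add μ ν hμ hν =>
    obtain ⟨d, P, hd, hP⟩ := hμ
    obtain ⟨e, Q, he, hQ⟩ := hν
    refine ⟨d * e, C e * P + C d * Q, mul_ne_zero hd he, ?_⟩
    simp only [Polynomial.map_add, Polynomial.map_mul, map_C, hP, hQ, map_mul, RingHom.coe_coe]
    ring
  | monomial n c =>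
    obtain ⟨r, s, hrs⟩ := (mem_adjoin_simple_iff K (c : E)).mp c.2
    rcases eq_or_ne s 0 with rfl | hs
    · refine ⟨1, 0, one_ne_zero, ?_⟩
      have : c = 0 := by simpa using hrs
      simp [this]
    · refine ⟨s, monomial n r, hs, ?_⟩
      have hs' : aeval b s ≠ 0 := fun h ↦ hb ⟨s, hs, h⟩
      have h : aeval b s * algebraMap K⟮b⟯ E c = aeval b r := by
        rw [IntermediateField.algebraMap_apply, hrs]
        field_simp
      simp only [map_monomial, RingHom.coe_coe, C_mul_monomial, h]

lemma natDegree_specialize_eq_natDegree_minpoly {a : Fin 2 → E} {i j : Fin 2} (hij : i ≠ j)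
    (hi : Transcendental K (a i)) (hj : IsIntegral K⟮a i⟯ (a j))
    {Cp : MvPolynomial (Fin 2) K} (h₀ : Cp ≠ 0)
    (hCp : ∀ G, MvPolynomial.aeval a G = 0 ↔ Cp ∣ G) :
    (specialize (X : K[X]) j Cp).natDegree = (minpoly K⟮a i⟯ (a j)).natDegree := by
  rw [← natDegree_specialize hi]
  apply le_antisymm
  · obtain ⟨d, P, hd, hP⟩ := exists_map_aeval_eq_C_mul hi (minpoly K⟮a i⟯ (a j))
    obtain ⟨G, rfl⟩ := exists_specialize_X_eq hij P
    rw [← specialize_eq_map] at hP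
    have hd' : aeval (a i) d ≠ 0 := fun h ↦ hi ⟨d, hd, h⟩
    have hG : Cp ∣ G := by
      rw [← hCp, ← eval_specialize a hij, hP]
      simp
    have := natDegree_le_of_dvd (map_dvd (specialize (a i) j) hG) (by
      rw [hP]
      exact mul_ne_zero (C_ne_zero.mpr hd')
        (Polynomial.map_ne_zero (minpoly.ne_zero hj)))
    rwa [hP, natDegree_C_mul hd', natDegree_map] at this
  · let b := AdjoinSimple.gen K (a i)
    have hmap : (specialize b j Cp).map (algebraMap K⟮a i⟯ E) = specialize (a i) j Cp :=
      map_specialize (K⟮a i⟯.val) b j Cp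
    rw [← hmap, natDegree_map]
    refine natDegree_le_of_dvd (minpoly.dvd _ _ ?_) fun h ↦ h₀ ?_
    · rw [aeval_def, eval₂_eq_eval_map, hmap, eval_specialize a hij, hCp]
    · apply specialize_injective hi j
      rw [← hmap, h, Polynomial.map_zero, map_zero]

lemma natDegree_minpoly_mul_finrank_adjoin (b : E) [FiniteDimensional K E] :
    (minpoly K b).natDegree * Module.finrank K⟮b⟯ E = Module.finrank K E := by
  rw [← adjoin.finrank (.of_finite K b), Module.finrank_mul_finrank]

lemma finiteDimensional_and_natDegree_minpoly_mul_finrank (a b : E)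
    [FiniteDimensional K⟮a⟯ E] : FiniteDimensional K⟮a, b⟯ E ∧
      (minpoly K⟮a⟯ b).natDegree * Module.finrank K⟮a, b⟯ E = Module.finrank K⟮a⟯ E := by
  rw [← adjoin_simple_adjoin_simple]
  change FiniteDimensional K⟮a⟯⟮b⟯ E ∧ _ * Module.finrank K⟮a⟯⟮b⟯ E = _
  exact ⟨FiniteDimensional.right K⟮a⟯ K⟮a⟯⟮b⟯ E, natDegree_minpoly_mul_finrank_adjoin b⟩

end Degree

section Sylvester

variable {R : Type*} [CommRing R]

/-- A matrix whose columns list, by decreasing powers of `X`, the coefficients of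
`X^(n-1) f, …, f, X^(m-1) g, …, g` has determinant the resultant of `f` and `g`. -/
lemma det_eq_resultant {m n N : ℕ} (hN : m + n = N + 1) {f g : R[X]}
    (hf : f.natDegree ≤ m) (hg : g.natDegree ≤ n) (S : Matrix (Fin (N + 1)) (Fin (N + 1)) R)
    (hS : ∀ i : Fin (N + 1), (∑ c : Fin (N + 1), C (S c i) * (X : R[X]) ^ (N - (c : ℕ))) =
      if (i : ℕ) < n then X ^ (n - 1 - (i : ℕ)) * f else X ^ (m + n - 1 - (i : ℕ)) * g) :
    S.det = resultant f g m n := by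
  have hcoeff (c i : Fin (N + 1)) : S c i =
      (if (i : ℕ) < n then X ^ (n - 1 - (i : ℕ)) * f
        else X ^ (m + n - 1 - (i : ℕ)) * g).coeff (N - c) := by
    rw [← hS i, finsetSum_coeff, Finset.sum_eq_single c]
    · simp
    · intro b _ hb
      rw [coeff_C_mul_X_pow, if_neg (by lia)]
    · simp
  let e : Fin (m + n) ≃ Fin (N + 1) := (finCongr hN).trans Fin.revPerm
  rw [resultant, ← Matrix.det_submatrix_equiv_self e]
  congr 1
  ext a b
  have he (c : Fin (m + n)) : (e c : ℕ) = N - c := by simp [e, Fin.val_rev]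
  rw [Matrix.submatrix_apply, hcoeff, he, he, sylvester, Matrix.of_apply]
  induction b using Fin.addCases with
  | left b =>
    rw [Fin.addCases_left, if_neg (by simp; lia), coeff_X_pow_mul']
    have h₁ : m + n - 1 - (N - (Fin.castAdd n b : ℕ)) = b := by simp; lia
    have h₂ : N - (N - (a : ℕ)) = a := by lia
    rw [h₁, h₂]
    by_cases h : (b : ℕ) ≤ a
    · by_cases h' : (a : ℕ) ≤ b + n
      · rw [if_pos h, if_pos ⟨h, h'⟩]
      · rw [if_pos h, if_neg fun h'' ↦ h' h''.2, coeff_eq_zero_of_natDegree_lt (by lia)]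
    · rw [if_neg h, if_neg fun h'' ↦ h h''.1]
  | right b =>
    rw [Fin.addCases_right, if_pos (by simp; lia), coeff_X_pow_mul']
    have h₁ : n - 1 - (N - (Fin.natAdd m b : ℕ)) = b := by simp; lia
    have h₂ : N - (N - (a : ℕ)) = a := by lia
    rw [h₁, h₂]
    by_cases h : (b : ℕ) ≤ a
    · by_cases h' : (a : ℕ) ≤ b + m
      · rw [if_pos h, if_pos ⟨h, h'⟩]
      · rw [if_pos h, if_neg fun h'' ↦ h' h''.2, coeff_eq_zero_of_natDegree_lt (by lia)]
    · rw [if_neg h, if_neg fun h'' ↦ h h''.1]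

end Sylvester

section Main

open IntermediateField

variable {K : Type*} [Field K] {p q : Fin 2 → K[X]}

lemma curveResultant_comm (p q : Fin 2 → K[X]) (i j : Fin 2) :
    Associated (curveResultant p q i j) (curveResultant p q j i) := by
  rw [curveResultant, resultant_comm]
  exact associated_unit_mul_left _ _ ((isUnit_one.neg).pow _)

lemma curveResultant_ne_zero_and_natDegree (hq : ∀ l, q l ≠ 0)
    (hdeg : ∀ l, 1 ≤ max (p l).natDegree (q l).natDegree)
    (hcop : ∀ l, IsCoprime (p l) (q l)) {i j : Fin 2} (hij : i ≠ j) :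
    curveResultant p q i j ≠ 0 ∧
      (specialize (X : K[X]) j (curveResultant p q i j)).natDegree =
        max (p i).natDegree (q i).natDegree := by
  have hφ : Transcendental K
      (algebraMap (RatFunc K) (AlgebraicClosure (RatFunc K)) (ratCoord (p i) (q i))) :=
    (transcendental_algebraMap_iff (FaithfulSMul.algebraMap_injective _ _)).mpr
      (transcendental_ratCoord (hq i) (hcop i) (hdeg i))
  obtain ⟨hne, h⟩ := specialize_curveResultant_ne_zero_and_natDegree hq (hdeg i) (hcop i) hφ hij
  exact ⟨fun h' ↦ hne (by rw [h', map_zero]), by rwa [natDegree_specialize hφ] at h⟩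

lemma exists_curveResultant_eq_C_mul_pow (hq : ∀ l, q l ≠ 0)
    (hdeg : ∀ l, 1 ≤ max (p l).natDegree (q l).natDegree)
    (hcop : ∀ l, IsCoprime (p l) (q l)) {Cp : MvPolynomial (Fin 2) K} (hCirr : Irreducible Cp)
    (hCimp : ∀ G, MvPolynomial.aeval (fun l ↦ ratCoord (p l) (q l)) G = 0 ↔ Cp ∣ G) :
    ∃ (k : ℕ) (u : K), u ≠ 0 ∧ curveResultant p q 0 1 = MvPolynomial.C u * Cp ^ k := by
  obtain ⟨k, Q, hCQ, hQ⟩ := WfDvdMonoid.max_power_factor'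
    (curveResultant_ne_zero_and_natDegree hq hdeg hcop zero_ne_one).1 hCirr.not_isUnit
  have hQR : Q ∣ curveResultant p q 0 1 := Dvd.intro_left _ hQ.symm
  have hQ' := (hCimp Q).not.mpr hCQ
  obtain ⟨u, rfl⟩ : ∃ u, Q = MvPolynomial.C u :=
    exists_eq_C_of_natDegree_specialize_eq_zero <| Fin.forall_fin_two.mpr
      ⟨natDegree_specialize_eq_zero_of_dvd hq hdeg hcop one_ne_zero
        (hQR.trans (curveResultant_comm p q 0 1).dvd) hQ',
      natDegree_specialize_eq_zero_of_dvd hq hdeg hcop zero_ne_one hQR hQ'⟩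
  exact ⟨k, u, fun h ↦ hCQ (by simp [h]), by rw [hQ, mul_comm]⟩

lemma curveResultant_eq_pow (hq : ∀ l, q l ≠ 0)
    (hdeg : ∀ l, 1 ≤ max (p l).natDegree (q l).natDegree)
    (hcop : ∀ l, IsCoprime (p l) (q l)) {Cp : MvPolynomial (Fin 2) K} (hCirr : Irreducible Cp)
    (hCimp : ∀ G, MvPolynomial.aeval (fun l ↦ ratCoord (p l) (q l)) G = 0 ↔ Cp ∣ G) :
    FiniteDimensional K⟮ratCoord (p 0) (q 0), ratCoord (p 1) (q 1)⟯ (RatFunc K) ∧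
    ∃ u : K, u ≠ 0 ∧ curveResultant p q 0 1 = MvPolynomial.C u *
      Cp ^ Module.finrank K⟮ratCoord (p 0) (q 0), ratCoord (p 1) (q 1)⟯ (RatFunc K) := by
  have hrank := finrank_adjoin_ratCoord (hq 0) (hcop 0)
  have hfin : FiniteDimensional K⟮ratCoord (p 0) (q 0)⟯ (RatFunc K) :=
    FiniteDimensional.of_finrank_pos (hrank ▸ hdeg 0)
  have hψ : IsIntegral K⟮ratCoord (p 0) (q 0)⟯ (ratCoord (p 1) (q 1)) := .of_finite _ _
  obtain ⟨hfin', htower⟩ := finiteDimensional_and_natDegree_minpoly_mul_finrank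
    (K := K) (ratCoord (p 0) (q 0)) (ratCoord (p 1) (q 1))
  obtain ⟨k, u, hu, hR⟩ := exists_curveResultant_eq_C_mul_pow hq hdeg hcop hCirr hCimp
  have hdegC := natDegree_specialize_eq_natDegree_minpoly
    (a := fun l ↦ ratCoord (p l) (q l)) zero_ne_one
    (transcendental_ratCoord (hq 0) (hcop 0) (hdeg 0)) hψ hCirr.ne_zero hCimp
  have hdegR := (curveResultant_ne_zero_and_natDegree hq hdeg hcop zero_ne_one).2
  rw [hR, map_mul, map_pow, ← MvPolynomial.algebraMap_eq, AlgHom.commutes,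
    Polynomial.algebraMap_apply, natDegree_C_mul (by simpa using hu), natDegree_pow, hdegC,
    mul_comm k, ← hrank, ← htower] at hdegR
  refine ⟨hfin', u, hu, ?_⟩
  rw [hR, Nat.eq_of_mul_eq_mul_left (minpoly.natDegree_pos hψ) hdegR]

end Main

end CurveResultant

/-- the resultant of a plane curve parameterization is a power of the
implicit equation.  Let `C ∈ K[x,y]` be an implicit equation of the curve parameterized
by `t ↦ (φ₁, φ₂) = (p₁/q₁, p₂/q₂)`.  The field extension `K(φ₁,φ₂) ⊆ K(t)` is finite, and
letting `e := [K(t) : K(φ₁,φ₂)]` be its degree, the resultant `Res_{m,n}(p₁ - x·q₁,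
p₂ - y·q₂)`, i.e. the determinant of the Sylvester matrix `S`, equals `C(x,y)^e` up to
multiplication by a nonzero constant of `K`. -/
theorem curve_resultant_eq_pow_degree_of_implicit_equation
    (K : Type*) [Field K] [CharZero K]
    (p₁ q₁ p₂ q₂ : Polynomial K)
    (hq₁ : q₁ ≠ 0) (hq₂ : q₂ ≠ 0)
    (hcop₁ : IsCoprime p₁ q₁) (hcop₂ : IsCoprime p₂ q₂)
    (m n : ℕ)
    (hm : m = max p₁.natDegree q₁.natDegree) (hm1 : 1 ≤ m)
    (hn : n = max p₂.natDegree q₂.natDegree) (hn1 : 1 ≤ n)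
    (N : ℕ) (hN : m + n = N + 1)
    (f g : Polynomial (MvPolynomial (Fin 2) K))
    (hf : f = p₁.map (algebraMap K (MvPolynomial (Fin 2) K)) -
      Polynomial.C (MvPolynomial.X 0) * q₁.map (algebraMap K (MvPolynomial (Fin 2) K)))
    (hg : g = p₂.map (algebraMap K (MvPolynomial (Fin 2) K)) -
      Polynomial.C (MvPolynomial.X 1) * q₂.map (algebraMap K (MvPolynomial (Fin 2) K)))
    (S : Matrix (Fin (N + 1)) (Fin (N + 1)) (MvPolynomial (Fin 2) K))
    (hS : ∀ i : Fin (N + 1),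
      (∑ c : Fin (N + 1), Polynomial.C (S c i) *
          (Polynomial.X : Polynomial (MvPolynomial (Fin 2) K)) ^ (N - (c : ℕ))) =
        if (i : ℕ) < n then Polynomial.X ^ (n - 1 - (i : ℕ)) * f
        else Polynomial.X ^ (m + n - 1 - (i : ℕ)) * g)
    (Cp : MvPolynomial (Fin 2) K) (hCirr : Irreducible Cp)
    (hCimp : ∀ G : MvPolynomial (Fin 2) K,
      MvPolynomial.aeval ![ratCoord p₁ q₁, ratCoord p₂ q₂] G = 0 ↔ Cp ∣ G) :
    FiniteDimensional
      (IntermediateField.adjoin K {ratCoord p₁ q₁, ratCoord p₂ q₂}) (RatFunc K) ∧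
    ∃ u : K, u ≠ 0 ∧
      S.det = MvPolynomial.C u * Cp ^ (Module.finrank
        (IntermediateField.adjoin K {ratCoord p₁ q₁, ratCoord p₂ q₂}) (RatFunc K)) := by
  have hq : ∀ l, (![q₁, q₂] : Fin 2 → K[X]) l ≠ 0 := Fin.forall_fin_two.mpr ⟨hq₁, hq₂⟩
  have hdeg : ∀ l, 1 ≤ max ((![p₁, p₂] : Fin 2 → K[X]) l).natDegree
      ((![q₁, q₂] : Fin 2 → K[X]) l).natDegree :=
    Fin.forall_fin_two.mpr ⟨hm ▸ hm1, hn ▸ hn1⟩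
  have hcop : ∀ l, IsCoprime ((![p₁, p₂] : Fin 2 → K[X]) l) ((![q₁, q₂] : Fin 2 → K[X]) l) :=
    Fin.forall_fin_two.mpr ⟨hcop₁, hcop₂⟩
  have hφ : ![ratCoord p₁ q₁, ratCoord p₂ q₂] =
      fun l ↦ ratCoord ((![p₁, p₂] : Fin 2 → K[X]) l) ((![q₁, q₂] : Fin 2 → K[X]) l) :=
    funext (Fin.forall_fin_two.mpr ⟨rfl, rfl⟩)
  rw [hφ] at hCimp
  have hdet : S.det = CurveResultant.curveResultant ![p₁, p₂] ![q₁, q₂] 0 1 := by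
    subst hm hn hf hg
    exact CurveResultant.det_eq_resultant hN (CurveResultant.natDegree_fiber_le _ _ _)
      (CurveResultant.natDegree_fiber_le _ _ _) S hS
  rw [hdet]
  exact CurveResultant.curveResultant_eq_pow hq hdeg hcop hCirr hCimp
end
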